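/- arXiv:hep-th/9910173 — 13 statements merged into one kernel-verified Lean document; each statement's English description precedes it below -/
import Mathlib

section
/- For every natural number n ≥ 1, every continuous function A : ℝ → Matrix (Fin n) (Fin n) ℂ, and every a ∈ ℝ, there exists a unique continuously differentiable function F : ℝ → Matrix (Fin n) (Fin n) ℂ such that F(a) = 1 (the identity matrix) and F'(x) = A(x) * F(x) for all x ∈ ℝ. -/
attribute [local instance] Matrix.linftyOpNormedAddCommGroup Matrix.linftyOpNormedRing
  Matrix.linftyOpNormedSpace Matrix.linftyOpNormedAlgebra

section DysonSeries

open Set MeasureTheory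
open scoped Interval NNReal Topology

lemma exists_norm_le_of_continuous_ball {E : Type*} [SeminormedAddCommGroup E]
    {A : ℝ → E} (hA : Continuous A) (a r : ℝ) :
    ∃ M, ∀ t ∈ Metric.ball a r, ‖A t‖ ≤ M := by
  obtain ⟨M, hM⟩ := (isCompact_closedBall a r).exists_bound_of_continuousOn hA.continuousOn
  exact ⟨M, fun t ht ↦ hM t (Metric.ball_subset_closedBall ht)⟩

variable {R : Type*} [NormedRing R] [NormedAlgebra ℝ R]

/-- The terms of the Dyson series of the linear equation `F' = A * F`, `F a = 1`: iterated
integrals of the coefficient `A`, starting from the constant function `1`. -/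
noncomputable def dysonTerm (A : ℝ → R) (a : ℝ) : ℕ → ℝ → R
  | 0 => fun _ ↦ 1
  | k + 1 => fun x ↦ ∫ t in a..x, A t * dysonTerm A a k t

variable {A : ℝ → R} {a : ℝ}

lemma dysonTerm_succ_self (k : ℕ) : dysonTerm A a (k + 1) a = 0 :=
  intervalIntegral.integral_same

lemma continuous_dysonTerm (hA : Continuous A) (k : ℕ) : Continuous (dysonTerm A a k) := by
  induction k with
  | zero => exact continuous_const
  | succ k ih =>
    exact intervalIntegral.continuous_primitive
      (fun _ _ ↦ (hA.mul ih).intervalIntegrable _ _) a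

lemma hasDerivAt_dysonTerm_succ [CompleteSpace R] (hA : Continuous A) (k : ℕ) (x : ℝ) :
    HasDerivAt (dysonTerm A a (k + 1)) (A x * dysonTerm A a k x) x :=
  (hA.mul (continuous_dysonTerm hA k)).integral_hasStrictDerivAt a x |>.hasDerivAt

lemma norm_dysonTerm_le (hA : Continuous A) {M : ℝ} {r : ℝ}
    (hM : ∀ t ∈ Metric.ball a r, ‖A t‖ ≤ M) (k : ℕ) {x : ℝ} (hx : x ∈ Metric.ball a r) :
    ‖dysonTerm A a k x‖ ≤ ‖(1 : R)‖ * ((M * |x - a|) ^ k / k.factorial) := by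
  induction k generalizing x with
  | zero => simp [dysonTerm]
  | succ k ih =>
    have hsub : Ι a x ⊆ Metric.ball a r := by
      refine uIoc_subset_uIcc.trans ?_
      exact (convex_ball a r).ordConnected.uIcc_subset
        (Metric.mem_ball_self (Metric.pos_of_mem_ball hx)) hx
    have hM0 : 0 ≤ M := (norm_nonneg _).trans (hM x hx)
    calc ‖dysonTerm A a (k + 1) x‖
        ≤ ∫ t in Ι a x, ‖A t * dysonTerm A a k t‖ :=
          intervalIntegral.norm_integral_le_integral_norm_uIoc
      _ ≤ ∫ t in Ι a x, ‖(1 : R)‖ * M ^ (k + 1) / k.factorial * |t - a| ^ k := by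
          refine setIntegral_mono_on ?_ ?_ measurableSet_uIoc fun t ht ↦ ?_
          · exact (Continuous.integrableOn_uIoc
              (hA.mul (continuous_dysonTerm hA k)).norm)
          · exact Continuous.integrableOn_uIoc (by fun_prop)
          · calc ‖A t * dysonTerm A a k t‖ ≤ ‖A t‖ * ‖dysonTerm A a k t‖ := norm_mul_le _ _
              _ ≤ M * (‖(1 : R)‖ * ((M * |t - a|) ^ k / k.factorial)) :=
                mul_le_mul (hM t (hsub ht)) (ih (hsub ht)) (norm_nonneg _) hM0
              _ = _ := by rw [mul_pow]; ring
      _ = _ := by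
          rw [integral_const_mul, integral_pow_abs_sub_uIoc, Nat.factorial_succ, mul_pow]
          push_cast
          field_simp

/-- The Dyson series solves the linear equation `F' = A * F`, `F a = 1` on the whole line. -/
lemma exists_hasDerivAt_mul [CompleteSpace R] (hA : Continuous A) (a : ℝ) :
    ∃ F : ℝ → R, F a = 1 ∧ ∀ x, HasDerivAt F (A x * F x) x := by
  refine ⟨fun x ↦ ∑' k, dysonTerm A a k x, ?_, fun x ↦ ?_⟩
  · beta_reduce
    rw [tsum_eq_single 0 fun k hk ↦ ?_]
    · rfl
    · obtain ⟨k, rfl⟩ := Nat.exists_eq_succ_of_ne_zero hk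
      exact dysonTerm_succ_self k
  · set r := |x - a| + 1 with hr
    have hxr : x ∈ Metric.ball a r := by simp [Metric.mem_ball, Real.dist_eq, hr]
    have har : a ∈ Metric.ball a r := Metric.mem_ball_self (by positivity)
    obtain ⟨M, hM⟩ := exists_norm_le_of_continuous_ball hA a r
    have hM0 : 0 ≤ M := (norm_nonneg _).trans (hM x hxr)
    set u : ℕ → ℝ := fun k ↦ ‖(1 : R)‖ * ((M * r) ^ k / k.factorial) with hu
    have hsu : Summable u := (Real.summable_pow_div_factorial _).mul_left _
    have hle (k : ℕ) {y : ℝ} (hy : y ∈ Metric.ball a r) : ‖dysonTerm A a k y‖ ≤ u k := by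
      refine (norm_dysonTerm_le hA hM k hy).trans ?_
      have : |y - a| ≤ r := (Metric.mem_ball.mp hy).le
      simp only [hu]
      gcongr
    have hsum {y : ℝ} (hy : y ∈ Metric.ball a r) : Summable fun k ↦ dysonTerm A a k y :=
      hsu.of_norm_bounded fun k ↦ hle k hy
    have hderiv : HasDerivAt (fun y ↦ ∑' k, dysonTerm A a (k + 1) y)
        (∑' k, A x * dysonTerm A a k x) x := by
      refine hasDerivAt_tsum_of_isPreconnected (hsu.mul_left M) Metric.isOpen_ball
        (convex_ball a r).isPreconnected (fun k y _ ↦ hasDerivAt_dysonTerm_succ hA k y)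
        (fun k y hy ↦ ?_) har ((summable_nat_add_iff 1).mpr (hsum har)) hxr
      exact (norm_mul_le _ _).trans (mul_le_mul (hM y hy) (hle k hy) (norm_nonneg _) hM0)
    rw [(hsum hxr).tsum_mul_left] at hderiv
    refine (hderiv.const_add 1).congr_of_eventuallyEq ?_
    filter_upwards [Metric.isOpen_ball.mem_nhds hxr] with y hy
    exact (hsum hy).tsum_eq_zero_add

/-- Solutions of the linear equation `F' = A * F` are determined by one value. -/
lemma eq_of_hasDerivAt_mul (hA : Continuous A) {F G : ℝ → R}
    (hF : ∀ x, HasDerivAt F (A x * F x) x) (hG : ∀ x, HasDerivAt G (A x * G x) x)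
    (h : F a = G a) : F = G := by
  ext x
  set r := |x - a| + 1 with hr
  have hxr : x ∈ Metric.ball a r := by simp [Metric.mem_ball, Real.dist_eq, hr]
  have har : a ∈ Metric.ball a r := Metric.mem_ball_self (by positivity)
  obtain ⟨M, hM⟩ := exists_norm_le_of_continuous_ball hA a r
  rw [Real.ball_eq_Ioo] at hxr har hM
  refine ODE_solution_unique_of_mem_Ioo (v := fun t y ↦ A t * y) (s := fun _ ↦ univ)
    (K := M.toNNReal) (fun t ht ↦ ?_) har (fun t _ ↦ ⟨hF t, trivial⟩)
    (fun t _ ↦ ⟨hG t, trivial⟩) h hxr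
  refine LipschitzOnWith.of_dist_le_mul fun y _ z _ ↦ ?_
  rw [dist_eq_norm, dist_eq_norm, ← mul_sub]
  refine (norm_mul_le _ _).trans ?_
  gcongr
  exact (hM t ht).trans (Real.le_coe_toNNReal M)

/-- The initial value problem `F' = A * F`, `F a = 1` with continuous coefficient `A` in a Banach
algebra has a unique continuously differentiable solution on the whole line. -/
lemma existsUnique_contDiff_hasDerivAt_mul [CompleteSpace R] (hA : Continuous A) (a : ℝ) :
    ∃! F : ℝ → R, ContDiff ℝ 1 F ∧ F a = 1 ∧ ∀ x, HasDerivAt F (A x * F x) x := by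
  obtain ⟨F, hFa, hF⟩ := exists_hasDerivAt_mul hA a
  refine ⟨F, ⟨?_, hFa, hF⟩, fun G hG ↦ eq_of_hasDerivAt_mul hA hG.2.2 hF (hG.2.1.trans hFa.symm)⟩
  have hd : Differentiable ℝ F := fun x ↦ (hF x).differentiableAt
  rw [contDiff_one_iff_deriv, funext fun x ↦ (hF x).deriv]
  exact ⟨hd, hA.mul hd.continuous⟩

end DysonSeries

/-- The product integral `∏_a^x e^{A(s)ds}`: for every continuous matrix-valued `A` and
every `a`, there is a unique continuously differentiable `F` with `F a = 1` and
`F' x = A x * F x` for all `x`. -/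
theorem product_integral_exists_unique (n : ℕ) (hn : 1 ≤ n)
    (A : ℝ → Matrix (Fin n) (Fin n) ℂ) (hA : Continuous A) (a : ℝ) :
    ∃! F : ℝ → Matrix (Fin n) (Fin n) ℂ,
      ContDiff ℝ 1 F ∧ F a = 1 ∧ ∀ x : ℝ, HasDerivAt F (A x * F x) x := by
  have : CompleteSpace (Matrix (Fin n) (Fin n) ℂ) := FiniteDimensional.complete ℝ _
  exact existsUnique_contDiff_hasDerivAt_mul hA a
end

section
/- Let A : ℝ → Matrix (Fin n) (Fin n) ℂ be continuous, a ∈ ℝ, and let F : ℝ → Matrix (Fin n) (Fin n) ℂ be differentiable with F'(x) = A(x) * F(x) for all x and F(a) = 1. Then for every x ∈ ℝ, det F(x) = exp(∫_a^x trace(A(s)) ds). -/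
attribute [local instance] Matrix.linftyOpNormedAddCommGroup Matrix.linftyOpNormedRing
  Matrix.linftyOpNormedSpace Matrix.linftyOpNormedAlgebra

theorem Matrix.differentiable_det_real {n : ℕ} :
    Differentiable ℝ (fun M : Matrix (Fin n) (Fin n) ℂ => M.det) := by
  have hentry : ∀ i j, Differentiable ℝ (fun M : Matrix (Fin n) (Fin n) ℂ => M i j) := fun i j =>
    (LinearMap.toContinuousLinearMap (Matrix.entryLinearMap ℝ ℂ i j)).differentiable
  simp only [Matrix.det_apply']
  fun_prop

/-- The derivative of `det (1 + t • M)` at `t = 0` is the trace of `M`. -/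
theorem Matrix.hasDerivAt_det_one_add_smul {n : ℕ} (M : Matrix (Fin n) (Fin n) ℂ) :
    HasDerivAt (fun t : ℝ => (1 + (t : ℂ) • M).det) M.trace 0 := by
  have hexp := funext fun t : ℝ => Matrix.det_one_add_smul (t : ℂ) M
  rw [hexp]
  set p := (1 + (Polynomial.X : Polynomial ℂ) • M.map Polynomial.C).det.divX.divX
  have h : HasDerivAt (fun z : ℂ => 1 + M.trace * z + p.eval z * z ^ 2) M.trace ((0 : ℝ) : ℂ) := by
    refine HasDerivAt.congr_deriv ((((hasDerivAt_id ((0 : ℝ) : ℂ)).const_mul M.trace).const_add 1).add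
      ((p.hasDerivAt ((0 : ℝ) : ℂ)).mul ((hasDerivAt_id ((0 : ℝ) : ℂ)).pow 2))) ?_
    simp
  exact h.comp_ofReal

/-- Derivative of the determinant along a solution of a linear matrix differential equation. -/
theorem HasDerivAt.matrix_det_of_mul {n : ℕ} {F : ℝ → Matrix (Fin n) (Fin n) ℂ}
    {M : Matrix (Fin n) (Fin n) ℂ} {x : ℝ} (hF : HasDerivAt F (M * F x) x) :
    HasDerivAt (fun y => (F y).det) (M.trace * (F x).det) x := by
  have hdet := (Matrix.differentiable_det_real (F x)).hasFDerivAt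
  have hline : HasDerivAt (fun t : ℝ => F x + t • (M * F x)) (M * F x) 0 := by
    exact (((hasDerivAt_id' (0 : ℝ)).smul_const (M * F x)).const_add (F x)).congr_deriv
      (one_smul ℝ _)
  have hline_det := HasFDerivAt.comp_hasDerivAt_of_eq (0 : ℝ) hdet hline (by simp)
  have hfactor : (fun t : ℝ => (F x + t • (M * F x)).det) =
      fun t : ℝ => (1 + (t : ℂ) • M).det * (F x).det := by
    funext t
    rw [← Matrix.det_mul, add_mul, one_mul, smul_mul_assoc, Complex.coe_smul]
  have htrace := (Matrix.hasDerivAt_det_one_add_smul M).mul_const (F x).det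
  rw [← hfactor] at htrace
  rw [htrace.unique hline_det]
  exact hdet.comp_hasDerivAt x hF

/-- The determinant of the product integral: if `F' = A·F` and `F a = 1`, then
`det (F x) = exp (∫_a^x tr (A s) ds)`. -/
theorem product_integral_det (n : ℕ)
    (A : ℝ → Matrix (Fin n) (Fin n) ℂ) (hA : Continuous A) (a : ℝ)
    (F : ℝ → Matrix (Fin n) (Fin n) ℂ)
    (hF : ∀ x : ℝ, HasDerivAt F (A x * F x) x) (hFa : F a = 1) :
    ∀ x : ℝ, (F x).det = Complex.exp (∫ s in a..x, (A s).trace) := by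
  have htr : Continuous fun s => (A s).trace := hA.matrix_trace
  have hprim : ∀ x, HasDerivAt (fun y => ∫ s in a..y, (A s).trace) (A x).trace x := fun x =>
    htr.integral_hasStrictDerivAt a x |>.hasDerivAt
  have hconst : ∀ x, HasDerivAt
      (fun y => (F y).det * Complex.exp (-∫ s in a..y, (A s).trace)) 0 x := fun x => by
    refine ((hF x).matrix_det_of_mul.mul (hprim x).neg.cexp).congr_deriv ?_
    ring
  intro x
  have h := is_const_of_deriv_eq_zero (fun y => (hconst y).differentiableAt)
    (fun y => (hconst y).deriv) x a
  simp only [hFa, Matrix.det_one, intervalIntegral.integral_same, neg_zero, Complex.exp_zero,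
    mul_one, Complex.exp_neg] at h
  exact (mul_inv_eq_one₀ (Complex.exp_ne_zero _)).mp h
end

section
/- Let A : ℝ → Matrix (Fin n) (Fin n) ℂ be continuous, a ∈ ℝ, and let F : ℝ → Matrix (Fin n) (Fin n) ℂ be differentiable with F'(x) = A(x) * F(x) for all x and F(a) = 1. Then F(x) is an invertible matrix for every x ∈ ℝ. -/
attribute [local instance] Matrix.linftyOpNormedAddCommGroup Matrix.linftyOpNormedRing
  Matrix.linftyOpNormedSpace Matrix.linftyOpNormedAlgebra

/-- A solution of the linear equation `G' = A·G` in a normed ring, with `A` continuous, that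
vanishes at one point vanishes everywhere. -/
theorem eq_zero_of_hasDerivAt_mul_of_eq_zero {R : Type*} [NormedRing R] [NormedSpace ℝ R]
    {A G : ℝ → R} (hA : Continuous A) (hG : ∀ t, HasDerivAt G (A t * G t) t)
    {x : ℝ} (hx : G x = 0) (a : ℝ) : G a = 0 := by
  obtain ⟨l, r, ha, hx'⟩ : ∃ l r, a ∈ Set.Ioo l r ∧ x ∈ Set.Ioo l r :=
    ⟨min a x - 1, max a x + 1, by grind, by grind⟩
  obtain ⟨C, hC⟩ := (isCompact_Icc (a := l) (b := r)).exists_bound_of_continuousOn hA.continuousOn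
  have hlip : ∀ t ∈ Set.Ioo l r,
      LipschitzOnWith C.toNNReal (fun y : R => A t * y) Set.univ := by
    intro t ht
    refine LipschitzOnWith.of_dist_le_mul fun y _ z _ => ?_
    rw [dist_eq_norm, dist_eq_norm, ← mul_sub]
    refine (norm_mul_le _ _).trans ?_
    gcongr
    exact (hC t (Set.Ioo_subset_Icc_self ht)).trans (Real.le_coe_toNNReal C)
  exact ODE_solution_unique_of_mem_Ioo (g := fun _ => (0 : R)) hlip hx'
    (fun t _ => ⟨hG t, trivial⟩)
    (fun t _ => ⟨by simpa using hasDerivAt_const t (0 : R), trivial⟩) hx ha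

/-- The product integral is non-singular: if `F' = A·F` and `F a = 1`, then `F x` is
invertible for every `x`. -/
theorem product_integral_invertible (n : ℕ)
    (A : ℝ → Matrix (Fin n) (Fin n) ℂ) (hA : Continuous A) (a : ℝ)
    (F : ℝ → Matrix (Fin n) (Fin n) ℂ)
    (hF : ∀ x : ℝ, HasDerivAt F (A x * F x) x) (hFa : F a = 1) :
    ∀ x : ℝ, IsUnit (F x) := by
  intro x
  rw [Matrix.isUnit_iff_isUnit_det, isUnit_iff_ne_zero]
  intro hdet
  obtain ⟨v, hv, hFv⟩ := Matrix.exists_mulVec_eq_zero_iff.mpr hdet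
  have hG : ∀ t, HasDerivAt (fun t => F t * Matrix.vecMulVec v (1 : Fin n → ℂ))
      (A t * (F t * Matrix.vecMulVec v 1)) t := fun t => by
    rw [← mul_assoc]
    exact HasDerivAt.mul_const (𝕜 := ℝ) (𝔸 := Matrix (Fin n) (Fin n) ℂ) (hF t) _
  have h : F a * Matrix.vecMulVec v 1 = 0 := eq_zero_of_hasDerivAt_mul_of_eq_zero
    (R := Matrix (Fin n) (Fin n) ℂ) (G := fun t => F t * Matrix.vecMulVec v 1) hA hG (x := x)
    (by rw [Matrix.mul_vecMulVec, hFv, Matrix.zero_vecMulVec]) a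
  rw [hFa, one_mul] at h
  refine hv (funext fun i => ?_)
  simpa [Matrix.vecMulVec_apply] using congrFun (congrFun h i) i
end

section
/- Let A : ℝ → Matrix (Fin n) (Fin n) ℂ be continuous and y, z ∈ ℝ. Let F_y and F_z be the solutions of the matrix differential equation G'(x) = A(x) * G(x) with initial conditions F_y(y) = 1 and F_z(z) = 1 respectively. Then for every x ∈ ℝ, F_z(x) = F_y(x) * F_z(y) (the composition rule ∏_z^x e^{A(s)ds} = ∏_y^x e^{A(s)ds} · ∏_z^y e^{A(s)ds}). -/
attribute [local instance] Matrix.linftyOpNormedAddCommGroup Matrix.linftyOpNormedRing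
  Matrix.linftyOpNormedSpace Matrix.linftyOpNormedAlgebra

/-- Two global solutions of the linear equation `f' = A * f` in a normed algebra that agree at one
point are equal. -/
theorem linear_ODE_solution_unique {R : Type*} [NormedRing R] [NormedAlgebra ℝ R]
    {A f g : ℝ → R} (hA : Continuous A) (hf : ∀ t, HasDerivAt f (A t * f t) t)
    (hg : ∀ t, HasDerivAt g (A t * g t) t) {t₀ : ℝ} (h₀ : f t₀ = g t₀) : f = g := by
  funext t
  obtain ⟨a, b, ht, ht₀⟩ : ∃ a b, t ∈ Set.Ioo a b ∧ t₀ ∈ Set.Ioo a b :=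
    ⟨min t t₀ - 1, max t t₀ + 1, by grind, by grind⟩
  obtain ⟨C, hC⟩ := (isCompact_Icc (a := a) (b := b)).exists_bound_of_continuousOn hA.continuousOn
  refine ODE_solution_unique_of_mem_Ioo (v := fun s u => A s * u) (s := fun _ => Set.univ)
    (K := C.toNNReal) (fun s hs => ?_) ht₀ (fun s _ => ⟨hf s, trivial⟩)
    (fun s _ => ⟨hg s, trivial⟩) h₀ ht
  refine (LipschitzWith.of_dist_le_mul fun u w => ?_).lipschitzOnWith
  rw [dist_eq_norm, dist_eq_norm, ← mul_sub]
  refine (norm_mul_le _ _).trans (mul_le_mul_of_nonneg_right ?_ (norm_nonneg _))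
  exact (hC s (Set.Ioo_subset_Icc_self hs)).trans (Real.le_coe_toNNReal C)

/-- The composition rule for product integrals:
`∏_z^x e^{A(s)ds} = ∏_y^x e^{A(s)ds} · ∏_z^y e^{A(s)ds}`. -/
theorem product_integral_composition (n : ℕ)
    (A : ℝ → Matrix (Fin n) (Fin n) ℂ) (hA : Continuous A) (y z : ℝ)
    (Fy Fz : ℝ → Matrix (Fin n) (Fin n) ℂ)
    (hFy : ∀ x : ℝ, HasDerivAt Fy (A x * Fy x) x) (hFyy : Fy y = 1)
    (hFz : ∀ x : ℝ, HasDerivAt Fz (A x * Fz x) x) (hFzz : Fz z = 1) :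
    ∀ x : ℝ, Fz x = Fy x * Fz y := by
  refine congrFun (linear_ODE_solution_unique (g := fun x => Fy x * Fz y) hA hFz
    (fun t => ?_) (t₀ := y) ?_)
  · simpa only [mul_assoc] using (hFy t).mul_const (Fz y)
  · simp [hFyy]
end

section
/- Let A : ℝ → Matrix (Fin n) (Fin n) ℂ be continuous, a ∈ ℝ, and let F be the solution of F'(x) = A(x) * F(x) with F(a) = 1; its values are invertible matrices. Fix b ∈ ℝ. Then the function y ↦ F(b) * F(y)⁻¹ is differentiable, and its derivative at y equals −(F(b) * F(y)⁻¹) * A(y); that is, ∂/∂y ∏_y^b e^{A(s)ds} = −(∏_y^b e^{A(s)ds}) * A(y). -/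
attribute [local instance] Matrix.linftyOpNormedAddCommGroup Matrix.linftyOpNormedRing
  Matrix.linftyOpNormedSpace Matrix.linftyOpNormedAlgebra

/-- In a complete normed algebra, if `f' = c * f` at `y` and `f y` is a unit, then
`(r * f⁻¹)' = -(r * f⁻¹) * c` at `y`. -/
theorem HasDerivAt.const_mul_ringInverse_of_mul_self {𝕜 R : Type*} [NontriviallyNormedField 𝕜]
    [NormedRing R] [NormedAlgebra 𝕜 R] [HasSummableGeomSeries R] {f : 𝕜 → R} {c : R} {y : 𝕜}
    (hf : HasDerivAt f (c * f y) y) (hu : IsUnit (f y)) (r : R) :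
    HasDerivAt (fun x => r * Ring.inverse (f x)) (-((r * Ring.inverse (f y)) * c)) y := by
  obtain ⟨u, hu⟩ := hu
  have h := hasFDerivAt_ringInverse (𝕜 := 𝕜) u
  rw [hu] at h
  refine ((h.comp_hasDerivAt y hf).const_mul r).congr_deriv ?_
  simp [← hu, mul_assoc]

/-- Derivative of the two-point product integral `∏_y^b e^{A(s)ds} = F b * (F y)⁻¹` with
respect to the lower end point:
`∂/∂y ∏_y^b e^{A(s)ds} = -(∏_y^b e^{A(s)ds}) * A(y)`. -/
theorem product_integral_deriv_lower_endpoint (n : ℕ)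
    (A : ℝ → Matrix (Fin n) (Fin n) ℂ) (hA : Continuous A) (a : ℝ)
    (F : ℝ → Matrix (Fin n) (Fin n) ℂ)
    (hF : ∀ x : ℝ, HasDerivAt F (A x * F x) x) (hFa : F a = 1)
    (hFinv : ∀ x : ℝ, IsUnit (F x)) (b : ℝ) :
    ∀ y : ℝ, HasDerivAt (fun y' : ℝ => F b * (F y')⁻¹) (-((F b * (F y)⁻¹) * A y)) y := by
  intro y
  have : CompleteSpace (Matrix (Fin n) (Fin n) ℂ) := FiniteDimensional.complete ℂ _
  simp_rw [Matrix.nonsing_inv_eq_ringInverse]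
  exact (hF y).const_mul_ringInverse_of_mul_self (hFinv y) (F b)
end

section
/- Let P : ℝ → Matrix (Fin n) (Fin n) ℂ be continuously differentiable with P(x) invertible for every x, and let a ∈ ℝ. Then the function x ↦ P(x) * P(a)⁻¹ is the unique solution F of the initial value problem F'(x) = (P'(x) * P(x)⁻¹) * F(x) with F(a) = 1; that is, ∏_a^x e^{(LP)(s)ds} = P(x) * P(a)⁻¹, where (LP)(s) = P'(s) * P(s)⁻¹. -/
attribute [local instance] Matrix.linftyOpNormedAddCommGroup Matrix.linftyOpNormedRing
  Matrix.linftyOpNormedSpace Matrix.linftyOpNormedAlgebra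

/-- The derivative of the pointwise inverse of a curve of units in a Banach algebra. -/
theorem HasDerivAt.ringInverse_comp {𝕜 R : Type*} [NontriviallyNormedField 𝕜] [NormedRing R]
    [NormedAlgebra 𝕜 R] [HasSummableGeomSeries R] {p : 𝕜 → R} {p' : R} {x : 𝕜}
    (hp : HasDerivAt p p' x) (hx : IsUnit (p x)) :
    HasDerivAt (fun y => Ring.inverse (p y))
      (-(Ring.inverse (p x) * p' * Ring.inverse (p x))) x := by
  obtain ⟨u, hu⟩ := hx
  have h := hasFDerivAt_ringInverse (𝕜 := 𝕜) u
  rw [hu] at h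
  have h' := h.comp_hasDerivAt x hp
  rw [← hu, Ring.inverse_unit]
  simpa [Function.comp_def] using h'

/-- Any solution `F` of `F' = (p' * p⁻¹) * F` is a right multiple of `p`, so that `p⁻¹ * F` is
constant. -/
theorem ringInverse_mul_eq_of_hasDerivAt {R : Type*} [NormedRing R] [NormedAlgebra ℝ R]
    [HasSummableGeomSeries R] {p p' F : ℝ → R} (hp : ∀ x, HasDerivAt p (p' x) x)
    (hu : ∀ x, IsUnit (p x))
    (hF : ∀ x, HasDerivAt F (p' x * Ring.inverse (p x) * F x) x) (x y : ℝ) :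
    Ring.inverse (p x) * F x = Ring.inverse (p y) * F y := by
  have hd : ∀ z, HasDerivAt (fun t => Ring.inverse (p t) * F t) 0 z := fun z =>
    (((hp z).ringInverse_comp (hu z)).mul (hF z)).congr_deriv (by noncomm_ring)
  exact is_const_of_deriv_eq_zero (fun z => (hd z).differentiableAt) (fun z => (hd z).deriv) x y

/-- The fundamental theorem of product integration:
`∏_a^x e^{(LP)(s)ds} = P x * (P a)⁻¹`, where `(LP)(s) = P'(s) * (P s)⁻¹`; i.e.
`x ↦ P x * (P a)⁻¹` is the unique solution of `F' = (LP)·F`, `F a = 1`. -/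
theorem product_integral_fundamental_theorem (n : ℕ)
    (P : ℝ → Matrix (Fin n) (Fin n) ℂ) (hP : ContDiff ℝ 1 P)
    (hPinv : ∀ x : ℝ, IsUnit (P x)) (a : ℝ) :
    ((∀ x : ℝ, HasDerivAt (fun y : ℝ => P y * (P a)⁻¹)
        ((deriv P x * (P x)⁻¹) * (P x * (P a)⁻¹)) x) ∧
      P a * (P a)⁻¹ = 1) ∧
    ∀ F : ℝ → Matrix (Fin n) (Fin n) ℂ,
      (∀ x : ℝ, HasDerivAt F ((deriv P x * (P x)⁻¹) * F x) x) → F a = 1 →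
        F = fun x : ℝ => P x * (P a)⁻¹ := by
  have hd : ∀ x, HasDerivAt P (deriv P x) x := fun x =>
    (hP.differentiable one_ne_zero x).hasDerivAt
  have hdet : ∀ x, IsUnit (P x).det := fun x => (Matrix.isUnit_iff_isUnit_det _).1 (hPinv x)
  refine ⟨⟨fun x => ?_, Matrix.mul_nonsing_inv _ (hdet a)⟩, fun F hF hFa => funext fun x => ?_⟩
  · refine ((hd x).mul_const (P a)⁻¹).congr_deriv ?_
    rw [Matrix.mul_assoc, Matrix.nonsing_inv_mul_cancel_left _ _ (hdet x)]
  · have h : (P x)⁻¹ * F x = (P a)⁻¹ * F a := by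
      simp only [Matrix.nonsing_inv_eq_ringInverse] at hF ⊢
      exact ringInverse_mul_eq_of_hasDerivAt hd hPinv hF x a
    rw [hFa, Matrix.mul_one] at h
    rw [← h, Matrix.mul_nonsing_inv_cancel_left _ _ (hdet x)]
end

section
/- Let A, B : ℝ → Matrix (Fin n) (Fin n) ℂ be continuous and a ∈ ℝ. Let P be the solution of P'(x) = A(x) * P(x) with P(a) = 1 (whose values are invertible), and let R be the solution of R'(x) = (P(x)⁻¹ * B(x) * P(x)) * R(x) with R(a) = 1. Then the function x ↦ P(x) * R(x) is the unique solution F of F'(x) = (A(x) + B(x)) * F(x) with F(a) = 1; that is, the sum rule ∏_a^x e^{[A(s)+B(s)]ds} = P(x) · ∏_a^x e^{P(s)⁻¹B(s)P(s)ds} holds. -/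
attribute [local instance] Matrix.linftyOpNormedAddCommGroup Matrix.linftyOpNormedRing
  Matrix.linftyOpNormedSpace Matrix.linftyOpNormedAlgebra

/-- A solution of the linear equation `F' = C·F` in a normed algebra, with continuous coefficient
`C`, is determined by its value at one point. -/
theorem linear_ode_solution_unique {E : Type*} [NormedRing E] [NormedAlgebra ℝ E]
    {C F G : ℝ → E} {a : ℝ} (hC : Continuous C) (hF : ∀ x, HasDerivAt F (C x * F x) x)
    (hG : ∀ x, HasDerivAt G (C x * G x) x) (h : F a = G a) : F = G := by
  ext t
  obtain ⟨l, u, ht, ha⟩ : ∃ l u, t ∈ Set.Ioo l u ∧ a ∈ Set.Ioo l u :=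
    ⟨min t a - 1, max t a + 1, by grind⟩
  obtain ⟨K, hK⟩ := (isCompact_Icc (a := l) (b := u)).exists_bound_of_continuousOn
    hC.continuousOn
  have hLip : ∀ s ∈ Set.Ioo l u, LipschitzOnWith K.toNNReal (fun y => C s * y) Set.univ := by
    intro s hs
    refine LipschitzOnWith.of_dist_le_mul fun x _ y _ => ?_
    rw [dist_eq_norm, dist_eq_norm, ← mul_sub]
    refine (norm_mul_le _ _).trans ?_
    gcongr
    exact (hK s (Set.Ioo_subset_Icc_self hs)).trans (Real.le_coe_toNNReal K)
  exact ODE_solution_unique_of_mem_Ioo hLip ha (fun s _ => ⟨hF s, trivial⟩)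
    (fun s _ => ⟨hG s, trivial⟩) h ht

/-- The sum rule for product integrals:
`∏_a^x e^{[A(s)+B(s)]ds} = P x · ∏_a^x e^{(P s)⁻¹ B s (P s) ds}`; i.e. `x ↦ P x * R x` is
the unique solution of `F' = (A + B)·F`, `F a = 1`. -/
theorem product_integral_sum_rule (n : ℕ)
    (A B : ℝ → Matrix (Fin n) (Fin n) ℂ) (hA : Continuous A) (hB : Continuous B) (a : ℝ)
    (P : ℝ → Matrix (Fin n) (Fin n) ℂ)
    (hP : ∀ x : ℝ, HasDerivAt P (A x * P x) x) (hPa : P a = 1)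
    (hPinv : ∀ x : ℝ, IsUnit (P x))
    (R : ℝ → Matrix (Fin n) (Fin n) ℂ)
    (hR : ∀ x : ℝ, HasDerivAt R (((P x)⁻¹ * B x * P x) * R x) x) (hRa : R a = 1) :
    ((∀ x : ℝ, HasDerivAt (fun y : ℝ => P y * R y) ((A x + B x) * (P x * R x)) x) ∧
      P a * R a = 1) ∧
    ∀ F : ℝ → Matrix (Fin n) (Fin n) ℂ,
      (∀ x : ℝ, HasDerivAt F ((A x + B x) * F x) x) → F a = 1 →
        F = fun x : ℝ => P x * R x := by
  have hPR (x : ℝ) : HasDerivAt (fun y : ℝ => P y * R y) ((A x + B x) * (P x * R x)) x := by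
    have hdet : IsUnit (P x).det := (Matrix.isUnit_iff_isUnit_det _).mp (hPinv x)
    have hderiv : A x * P x * R x + P x * ((P x)⁻¹ * B x * P x * R x) =
        (A x + B x) * (P x * R x) := by
      simp only [Matrix.mul_assoc, Matrix.mul_nonsing_inv_cancel_left _ _ hdet, Matrix.add_mul]
    rw [← hderiv]
    exact (hP x).mul (hR x)
  have hPRa : P a * R a = 1 := by rw [hPa, hRa, mul_one]
  exact ⟨⟨hPR, hPRa⟩, fun F hF hFa =>
    linear_ode_solution_unique (hA.add hB) hF hPR (hFa.trans hPRa.symm)⟩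
end

section
/- Let A : ℝ × ℝ → Matrix (Fin n) (Fin n) ℂ, (s, λ) ↦ A(s; λ), be continuous, with the partial derivative ∂A/∂λ existing and jointly continuous. For y, λ ∈ ℝ let F(·, y; λ) be the solution of ∂F/∂x (x, y; λ) = A(x; λ) * F(x, y; λ) with F(y, y; λ) = 1, and for any x, s set P(x, s; λ) = F(x, y; λ) * F(s, y; λ)⁻¹ (the two-point product integral ∏_s^x e^{A(u;λ)du}, independent of y). Then for all x, y, λ, the partial derivative of λ ↦ P(x, y; λ) exists and equals ∫_y^x P(x, s; λ) * (∂A/∂λ)(s; λ) * P(s, y; λ) ds. -/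
attribute [local instance] Matrix.linftyOpNormedAddCommGroup Matrix.linftyOpNormedRing
  Matrix.linftyOpNormedSpace Matrix.linftyOpNormedAlgebra

section LinearODE

open Set Filter Topology
open scoped Ring

variable {R : Type*} [NormedRing R] [NormedAlgebra ℝ R]

theorem norm_le_mul_exp_of_hasDerivAt_mul_of_le {a f : ℝ → R} {K x y : ℝ} (hyx : y ≤ x)
    (hf : ∀ t, HasDerivAt f (a t * f t) t) (hK : ∀ t ∈ Icc y x, ‖a t‖ ≤ K) :
    ‖f x‖ ≤ ‖f y‖ * Real.exp (K * (x - y)) := by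
  have h := norm_le_gronwallBound_of_norm_deriv_right_le (f := f) (ε := 0) (K := K)
    (fun t _ => (hf t).continuousAt.continuousWithinAt) (fun t _ => (hf t).hasDerivWithinAt)
    le_rfl (fun t ht => ?_) x (right_mem_Icc.2 hyx)
  · rwa [gronwallBound_ε0] at h
  · rw [add_zero]
    exact (norm_mul_le _ _).trans
      (mul_le_mul_of_nonneg_right (hK t (Ico_subset_Icc_self ht)) (norm_nonneg _))

/-- Grönwall's bound for the linear equation `f' = a * f`, valid in both time directions. -/
theorem norm_le_mul_exp_of_hasDerivAt_mul {a f : ℝ → R} {K x y : ℝ}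
    (hf : ∀ t, HasDerivAt f (a t * f t) t) (hK : ∀ t ∈ uIcc y x, ‖a t‖ ≤ K) :
    ‖f x‖ ≤ ‖f y‖ * Real.exp (K * |x - y|) := by
  rcases le_total y x with h | h
  · rw [abs_of_nonneg (sub_nonneg.2 h)]
    exact norm_le_mul_exp_of_hasDerivAt_mul_of_le h hf fun t ht => hK t (uIcc_of_le h ▸ ht)
  · rw [abs_of_nonpos (sub_nonpos.2 h)]
    have key := norm_le_mul_exp_of_hasDerivAt_mul_of_le (a := fun t => -a (-t))
      (f := fun t => f (-t)) (K := K) (neg_le_neg h) (fun t => ?_) (fun t ht => ?_)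
    · simpa [neg_add_eq_sub] using key
    · simpa [Function.comp_def] using! (hf (-t)).scomp t (hasDerivAt_neg t)
    · rw [norm_neg]
      refine hK _ (uIcc_of_ge h ▸ ⟨?_, ?_⟩) <;> linarith [ht.1, ht.2]

variable [CompleteSpace R]

/-- Duhamel's formula comparing solutions of two linear equations. -/
theorem mul_integral_eq_sub_of_hasDerivAt_mul {a b f g : ℝ → R} (ha : Continuous a)
    (hb : Continuous b) (hf : ∀ t, HasDerivAt f (a t * f t) t)
    (hg : ∀ t, HasDerivAt g (b t * g t) t) (hfu : ∀ t, IsUnit (f t)) (x y : ℝ) :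
    f x * ∫ s in y..x, (f s)⁻¹ʳ * (b s - a s) * g s = g x - f x * (f y)⁻¹ʳ * g y := by
  have hfc : Continuous f := continuous_iff_continuousAt.2 fun t => (hf t).continuousAt
  have hgc : Continuous g := continuous_iff_continuousAt.2 fun t => (hg t).continuousAt
  have hinv : ∀ t, HasDerivAt (fun s => (f s)⁻¹ʳ) (-((f t)⁻¹ʳ * a t)) t := fun t => by
    obtain ⟨u, hu⟩ := hfu t
    have h := (hasFDerivAt_ringInverse (𝕜 := ℝ) u).comp_hasDerivAt_of_eq t (hf t) hu
    convert! h using 1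
    simp [← hu, mul_assoc]
  have hic : Continuous fun s => (f s)⁻¹ʳ :=
    continuous_iff_continuousAt.2 fun t => (hinv t).continuousAt
  rw [intervalIntegral.integral_eq_sub_of_hasDerivAt (f := fun s => (f s)⁻¹ʳ * g s)
    (fun t _ => ?_) (Continuous.intervalIntegrable (by fun_prop) _ _)]
  · rw [mul_sub, ← mul_assoc, ← mul_assoc, Ring.mul_inverse_cancel _ (hfu x), one_mul]
  · convert! (hinv t).mul (hg t) using 1
    noncomm_ring

/-- The fundamental solution of a linear equation is differentiable with respect to a parameter. -/
theorem hasDerivAt_param_of_hasDerivAt_mul {A A' F : ℝ → ℝ → R} {y : ℝ}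
    (hA : Continuous fun p : ℝ × ℝ => A p.1 p.2)
    (hA' : ∀ s l, HasDerivAt (fun l' => A s l') (A' s l) l)
    (hA'cont : Continuous fun p : ℝ × ℝ => A' p.1 p.2)
    (hF : ∀ x l, HasDerivAt (fun x' => F x' l) (A x l * F x l) x)
    (hFinit : ∀ l, F y l = 1) (hFu : ∀ x l, IsUnit (F x l)) (x l : ℝ) :
    HasDerivAt (fun l' => F x l')
      (∫ s in y..x, F x l * (F s l)⁻¹ʳ * A' s l * F s l) l := by
  have hAc : ∀ l', Continuous fun s => A s l' := fun l' => by fun_prop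
  have hFc : ∀ l', Continuous fun s => F s l' := fun l' =>
    continuous_iff_continuousAt.2 fun t => (hF t l').continuousAt
  have hic : Continuous fun s => (F s l)⁻¹ʳ := continuous_iff_continuousAt.2 fun t =>
    ContinuousAt.comp (f := fun s => F s l) (g := Ring.inverse)
      ((hFu t l).unit_spec ▸ NormedRing.inverse_continuousAt (hFu t l).unit)
      (hFc l).continuousAt
  have hcpt : IsCompact (uIcc y x ×ˢ Metric.closedBall l 1) :=
    isCompact_uIcc.prod (isCompact_closedBall l 1)
  obtain ⟨K, hK⟩ := hcpt.exists_bound_of_continuousOn hA.continuousOn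
  obtain ⟨M, hM⟩ := hcpt.exists_bound_of_continuousOn hA'cont.continuousOn
  obtain ⟨V, hV⟩ := (isCompact_uIcc (a := y) (b := x)).exists_bound_of_continuousOn hic.continuousOn
  obtain ⟨W, hW⟩ :=
    (isCompact_uIcc (a := y) (b := x)).exists_bound_of_continuousOn (hFc l).continuousOn
  have hK0 : 0 ≤ K := (norm_nonneg _).trans (hK (y, l) ⟨left_mem_uIcc, by simp⟩)
  have hM0 : 0 ≤ M := (norm_nonneg _).trans (hM (y, l) ⟨left_mem_uIcc, by simp⟩)
  have hV0 : 0 ≤ V := (norm_nonneg _).trans (hV y left_mem_uIcc)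
  set B := ‖(1 : R)‖ * Real.exp (K * |x - y|) with hB
  have hFB : ∀ s ∈ uIcc y x, ∀ l' ∈ Metric.closedBall l 1, ‖F s l'‖ ≤ B := by
    intro s hs l' hl'
    have h := norm_le_mul_exp_of_hasDerivAt_mul (K := K) (y := y) (x := s) (fun t => hF t l')
      fun t ht => hK (t, l') ⟨uIcc_subset_uIcc_left hs ht, hl'⟩
    rw [hFinit] at h
    refine h.trans ?_
    rw [hB]
    gcongr ‖(1 : R)‖ * Real.exp (K * ?_)
    exact abs_sub_left_of_mem_uIcc hs
  have hAlip : ∀ s ∈ uIcc y x, ∀ l' ∈ Metric.closedBall l 1, ‖A s l' - A s l‖ ≤ M * ‖l' - l‖ :=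
    fun s hs l' hl' => (convex_closedBall l 1).norm_image_sub_le_of_norm_hasDerivWithin_le
      (fun t _ => (hA' s t).hasDerivWithinAt) (fun t ht => hM (s, t) ⟨hs, ht⟩)
      (Metric.mem_closedBall_self zero_le_one) hl'
  have duhamel : ∀ s l', F s l' - F s l =
      F s l * ∫ t in y..s, (F t l)⁻¹ʳ * (A t l' - A t l) * F t l' := fun s l' => by
    rw [mul_integral_eq_sub_of_hasDerivAt_mul (hAc l) (hAc l') (fun t => hF t l)
      (fun t => hF t l') (fun t => hFu t l), hFinit, hFinit]
    simp
  have hball : ∀ᶠ l' in 𝓝 l, l' ∈ Metric.closedBall l 1 := Metric.closedBall_mem_nhds l one_pos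
  have hFlim : ∀ s ∈ uIcc y x, Tendsto (fun l' => F s l') (𝓝 l) (𝓝 (F s l)) := by
    intro s hs
    rw [tendsto_iff_norm_sub_tendsto_zero]
    have hlim : Tendsto (fun l' => W * (V * (M * ‖l' - l‖) * B * |s - y|)) (𝓝 l) (𝓝 0) := by
      have : Continuous fun l' => W * (V * (M * ‖l' - l‖) * B * |s - y|) := by fun_prop
      simpa using this.tendsto l
    refine squeeze_zero' (.of_forall fun _ => norm_nonneg _) ?_ hlim
    filter_upwards [hball] with l' hl'
    rw [duhamel]
    refine (norm_mul_le _ _).trans ?_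
    gcongr
    · exact (norm_nonneg _).trans (hW s hs)
    · exact hW s hs
    · refine intervalIntegral.norm_integral_le_of_norm_le_const fun t ht => ?_
      have ht' := uIcc_subset_uIcc_left hs (uIoc_subset_uIcc ht)
      refine norm_mul₃_le.trans ?_
      gcongr
      exacts [hV t ht', hAlip t ht' l' hl', hFB t ht' l' hl']
  have hcont : Continuous fun s => (F s l)⁻¹ʳ * A' s l * F s l := by fun_prop
  have hpull : ∫ s in y..x, F x l * (F s l)⁻¹ʳ * A' s l * F s l =
      F x l * ∫ s in y..x, (F s l)⁻¹ʳ * A' s l * F s l := by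
    simpa [mul_assoc] using (ContinuousLinearMap.mul ℝ R (F x l)).intervalIntegral_comp_comm
      (hcont.intervalIntegrable y x)
  rw [hasDerivAt_iff_tendsto_slope, hpull]
  have hslope : ∀ l', slope (fun l' => F x l') l l' =
      F x l * ∫ s in y..x, (F s l)⁻¹ʳ * slope (fun l' => A s l') l l' * F s l' := fun l' => by
    simp only [slope_def_module, duhamel x l', mul_smul_comm, smul_mul_assoc,
      intervalIntegral.integral_smul]
  rw [funext hslope]
  refine Tendsto.const_mul _ ?_
  refine intervalIntegral.tendsto_integral_filter_of_dominated_convergence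
    (fun _ => V * M * B) (.of_forall fun l' => ?_) ?_ intervalIntegrable_const
    (.of_forall fun s hs => ?_)
  · have hs : Continuous fun s => slope (fun l' => A s l') l l' := by
      simp only [slope_def_module]
      fun_prop
    exact ((hic.mul hs).mul (hFc l')).aestronglyMeasurable
  · filter_upwards [nhdsWithin_le_nhds hball, self_mem_nhdsWithin] with l' hl' hne
    refine .of_forall fun s hs => norm_mul₃_le.trans ?_
    have hs' := uIoc_subset_uIcc hs
    gcongr
    · exact hV s hs'
    · rw [slope_def_module, norm_smul, norm_inv,
        inv_mul_le_iff₀ (norm_pos_iff.2 (sub_ne_zero.2 hne)), mul_comm]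
      exact hAlip s hs' l' hl'
    · exact hFB s hs' l' hl'
  · exact ((hA' s l).tendsto_slope.const_mul _).mul
      ((hFlim s (uIoc_subset_uIcc hs)).mono_left nhdsWithin_le_nhds)

end LinearODE

/-- Differentiation of a product integral with respect to a parameter:
`∂/∂λ P(x,y;λ) = ∫_y^x P(x,s;λ) (∂A/∂λ)(s;λ) P(s,y;λ) ds`, where
`P(x,s;λ) = F(x,y;λ) * F(s,y;λ)⁻¹` is the two-point product integral `∏_s^x e^{A(u;λ)du}`
(independent of the base point `y`). -/
theorem product_integral_param_deriv (n : ℕ)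
    (A A' : ℝ → ℝ → Matrix (Fin n) (Fin n) ℂ)
    (hA : Continuous fun p : ℝ × ℝ => A p.1 p.2)
    (hA' : ∀ (s l : ℝ), HasDerivAt (fun l' : ℝ => A s l') (A' s l) l)
    (hA'cont : Continuous fun p : ℝ × ℝ => A' p.1 p.2)
    (F : ℝ → ℝ → ℝ → Matrix (Fin n) (Fin n) ℂ)
    (hF : ∀ (x y l : ℝ), HasDerivAt (fun x' : ℝ => F x' y l) (A x l * F x y l) x)
    (hFinit : ∀ (y l : ℝ), F y y l = 1)
    (hFinv : ∀ (x y l : ℝ), IsUnit (F x y l))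
    (P : ℝ → ℝ → ℝ → Matrix (Fin n) (Fin n) ℂ)
    (hP : ∀ (x s y l : ℝ), P x s l = F x y l * (F s y l)⁻¹) :
    ∀ (x y l : ℝ),
      HasDerivAt (fun l' : ℝ => P x y l')
        (∫ s in y..x, P x s l * A' s l * P s y l) l := by
  intro x y l
  have hPF : ∀ s l', P s y l' = F s y l' := fun s l' => by rw [hP s y y l', hFinit]; simp
  simpa only [hPF, hP x _ y l, Matrix.nonsing_inv_eq_ringInverse] using!
    hasDerivAt_param_of_hasDerivAt_mul hA hA' hA'cont (fun x l => hF x y l) (hFinit y)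
      (fun x l => hFinv x y l) x l
end

section
/- With the Wilson-loop setup below, for all σ, τ ∈ ℝ the partial derivative of W(σ, τ) with respect to τ exists and satisfies ∂_τ W(σ, τ) * W(σ, τ)⁻¹ = T(σ, τ)⁻¹ * (A₀(σ, τ) − ∂_τ T(σ, τ) * T(σ, τ)⁻¹) * T(σ, τ). -/
attribute [local instance] Matrix.linftyOpNormedAddCommGroup Matrix.linftyOpNormedRing
  Matrix.linftyOpNormedSpace Matrix.linftyOpNormedAlgebra

section ParametricLinearODE

open Set Filter Topology MeasureTheory

variable {R : Type*} [NormedRing R] [NormedAlgebra ℝ R]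

/-- A `C¹` family is bounded and Lipschitz in the parameter, uniformly on the unit interval. -/
lemma ContDiff.exists_bound_and_lipschitz_parameter {B : ℝ → ℝ → R}
    (hB : ContDiff ℝ 1 fun p : ℝ × ℝ => B p.1 p.2) (τ : ℝ) :
    ∃ K L : ℝ, 0 ≤ L ∧ ∀ t ∈ Icc (0 : ℝ) 1, ∀ τ' ∈ Metric.closedBall τ 1,
      ‖B t τ'‖ ≤ K ∧ ‖B t τ' - B t τ‖ ≤ L * |τ' - τ| := by
  have hcpt : IsCompact (Icc (0 : ℝ) 1 ×ˢ Metric.closedBall τ 1) :=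
    isCompact_Icc.prod (isCompact_closedBall τ 1)
  obtain ⟨K, hK⟩ := hcpt.exists_bound_of_continuousOn hB.continuous.continuousOn
  obtain ⟨L, hL⟩ := hB.locallyLipschitz.locallyLipschitzOn.exists_lipschitzOnWith_of_compact hcpt
  refine ⟨K, L, L.2, fun t ht τ' hτ' => ⟨hK (t, τ') ⟨ht, hτ'⟩, ?_⟩⟩
  have h := hL.dist_le_mul (t, τ') ⟨ht, hτ'⟩ (t, τ) ⟨ht, by simp⟩
  rwa [dist_eq_norm, Prod.dist_eq, dist_self, max_eq_right dist_nonneg, Real.dist_eq] at h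

variable {B f : ℝ → ℝ → R}

/-- Solutions of a linear ODE on the unit interval are bounded, locally uniformly in the
parameter. -/
lemma exists_bound_linearODE_parameter
    (hB : ContDiff ℝ 1 fun p : ℝ × ℝ => B p.1 p.2)
    (hf : ∀ t τ, HasDerivAt (fun t' => f t' τ) (B t τ * f t τ) t) (hf0 : ∀ τ, f 0 τ = 1)
    (τ : ℝ) :
    ∃ M : ℝ, ∀ t ∈ Icc (0 : ℝ) 1, ∀ τ' ∈ Metric.closedBall τ 1, ‖f t τ'‖ ≤ M := by
  obtain ⟨K, L, -, hKL⟩ := hB.exists_bound_and_lipschitz_parameter τ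
  have hcpt := (isCompact_Icc (a := (0 : ℝ)) (b := 1)).exists_bound_of_continuousOn
    (f := fun t => gronwallBound ‖(1 : R)‖ K 0 t)
    (fun t _ => (hasDerivAt_gronwallBound _ _ _ t).continuousAt.continuousWithinAt)
  obtain ⟨M, hM⟩ := hcpt
  refine ⟨M, fun t ht τ' hτ' => le_trans ?_ ((le_abs_self _).trans (hM t ht))⟩
  have h := norm_le_gronwallBound_of_norm_deriv_right_le (f := fun t => f t τ')
    (δ := ‖(1 : R)‖) (K := K) (ε := 0) (a := 0) (b := 1)
    (fun s _ => (hf s τ').continuousAt.continuousWithinAt)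
    (fun s _ => (hf s τ').hasDerivWithinAt) (by rw [hf0]) (fun s hs => ?_) t ht
  · simpa using h
  · rw [add_zero]
    exact (norm_mul_le _ _).trans
      (mul_le_mul_of_nonneg_right (hKL s (Ico_subset_Icc_self hs) τ' hτ').1 (norm_nonneg _))

/-- Solutions of a linear ODE depend continuously on the parameter. -/
lemma continuousAt_linearODE_parameter
    (hB : ContDiff ℝ 1 fun p : ℝ × ℝ => B p.1 p.2)
    (hf : ∀ t τ, HasDerivAt (fun t' => f t' τ) (B t τ * f t τ) t) (hf0 : ∀ τ, f 0 τ = 1)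
    {t : ℝ} (ht : t ∈ Icc (0 : ℝ) 1) (τ : ℝ) :
    ContinuousAt (fun τ' => f t τ') τ := by
  obtain ⟨K, L, hL0, hKL⟩ := hB.exists_bound_and_lipschitz_parameter τ
  obtain ⟨M, hM⟩ := exists_bound_linearODE_parameter hB hf hf0 τ
  have hle : ∀ᶠ τ' in 𝓝 τ, ‖f t τ' - f t τ‖ ≤ gronwallBound 0 K (L * |τ' - τ| * M) t := by
    filter_upwards [Metric.closedBall_mem_nhds τ one_pos] with τ' hτ'
    have h := norm_le_gronwallBound_of_norm_deriv_right_le (f := fun t => f t τ' - f t τ)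
      (δ := 0) (K := K) (ε := L * |τ' - τ| * M) (a := 0) (b := 1)
      (fun s _ => ((hf s τ').sub (hf s τ)).continuousAt.continuousWithinAt)
      (fun s _ => ((hf s τ').sub (hf s τ)).hasDerivWithinAt) (by simp [hf0])
      (fun s hs => ?_) t ht
    · simpa using h
    · replace hs := Ico_subset_Icc_self hs
      have hsplit : B s τ' * f s τ' - B s τ * f s τ =
          B s τ * (f s τ' - f s τ) + (B s τ' - B s τ) * f s τ' := by noncomm_ring
      rw [hsplit]
      refine (norm_add_le _ _).trans (add_le_add ((norm_mul_le _ _).trans ?_)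
        ((norm_mul_le _ _).trans ?_))
      · exact mul_le_mul_of_nonneg_right (hKL s hs τ (by simp)).1 (norm_nonneg _)
      · exact mul_le_mul (hKL s hs τ' hτ').2 (hM s hs τ' hτ') (norm_nonneg _) (by positivity)
  have hlim : Tendsto (fun τ' => gronwallBound 0 K (L * |τ' - τ| * M) t) (𝓝 τ) (𝓝 0) := by
    have hc : Continuous fun τ' => gronwallBound 0 K (L * |τ' - τ| * M) t :=
      (gronwallBound_continuous_ε 0 K t).comp (by fun_prop)
    simpa [gronwallBound_ε0_δ0] using hc.tendsto τ
  exact tendsto_iff_norm_sub_tendsto_zero.2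
    (squeeze_zero' (.of_forall fun _ => norm_nonneg _) hle hlim)

lemma HasDerivAt.ringInverse [CompleteSpace R] {g : ℝ → R} {g' : R} {t : ℝ}
    (hg : HasDerivAt g g' t) (hu : IsUnit (g t)) :
    HasDerivAt (fun s => Ring.inverse (g s))
      (-(Ring.inverse (g t) * g' * Ring.inverse (g t))) t := by
  obtain ⟨u, hu⟩ := hu
  have h := hasFDerivAt_ringInverse (𝕜 := ℝ) u
  rw [hu] at h
  exact (h.comp_hasDerivAt t hg).congr_deriv (by simp [← hu])

/-- Variation of constants: comparison of the solutions for two parameter values. -/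
lemma linearODE_parameter_eq_mul_integral [CompleteSpace R]
    (hB : ContDiff ℝ 1 fun p : ℝ × ℝ => B p.1 p.2)
    (hf : ∀ t τ, HasDerivAt (fun t' => f t' τ) (B t τ * f t τ) t) (hf0 : ∀ τ, f 0 τ = 1)
    (hu : ∀ t τ, IsUnit (f t τ)) (τ τ' : ℝ) :
    f 1 τ' = f 1 τ *
      (1 + ∫ s in (0 : ℝ)..1, Ring.inverse (f s τ) * (B s τ' - B s τ) * f s τ') := by
  have hcont (r : ℝ) : Continuous fun s => f s r :=
    continuous_iff_continuousAt.2 fun s => (hf s r).continuousAt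
  have hinv : Continuous fun s => Ring.inverse (f s τ) :=
    continuous_iff_continuousAt.2 fun s => ((hf s τ).ringInverse (hu s τ)).continuousAt
  have hBc (r : ℝ) : Continuous fun s => B s r := hB.continuous.comp (.prodMk_left r)
  have hderiv (s : ℝ) : HasDerivAt (fun s => Ring.inverse (f s τ) * f s τ')
      (Ring.inverse (f s τ) * (B s τ' - B s τ) * f s τ') s := by
    refine (((hf s τ).ringInverse (hu s τ)).mul (hf s τ')).congr_deriv ?_
    have h := Ring.mul_inverse_cancel _ (hu s τ)
    have h2 : Ring.inverse (f s τ) * (B s τ * f s τ) * Ring.inverse (f s τ) =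
        Ring.inverse (f s τ) * B s τ := by
      rw [mul_assoc, mul_assoc, h, mul_one]
    rw [h2]
    noncomm_ring
  rw [intervalIntegral.integral_eq_sub_of_hasDerivAt (fun s _ => hderiv s)
    (((hinv.mul ((hBc τ').sub (hBc τ))).mul (hcont τ')).intervalIntegrable 0 1)]
  simp only [hf0, Ring.inverse_one, mul_one, add_sub_cancel]
  rw [← mul_assoc, Ring.mul_inverse_cancel _ (hu 1 τ), one_mul]

/-- Solutions of a linear ODE at time one are differentiable in the parameter. -/
lemma differentiableAt_linearODE_parameter [CompleteSpace R]
    (hB : ContDiff ℝ 1 fun p : ℝ × ℝ => B p.1 p.2)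
    (hf : ∀ t τ, HasDerivAt (fun t' => f t' τ) (B t τ * f t τ) t) (hf0 : ∀ τ, f 0 τ = 1)
    (hu : ∀ t τ, IsUnit (f t τ)) (τ : ℝ) :
    DifferentiableAt ℝ (fun τ' => f 1 τ') τ := by
  obtain ⟨K, L, hL0, hKL⟩ := hB.exists_bound_and_lipschitz_parameter τ
  obtain ⟨M, hM⟩ := exists_bound_linearODE_parameter hB hf hf0 τ
  have hcont (r : ℝ) : Continuous fun s => f s r :=
    continuous_iff_continuousAt.2 fun s => (hf s r).continuousAt
  have hinv : Continuous fun s => Ring.inverse (f s τ) :=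
    continuous_iff_continuousAt.2 fun s => ((hf s τ).ringInverse (hu s τ)).continuousAt
  have hBc (r : ℝ) : Continuous fun s => B s r := hB.continuous.comp (.prodMk_left r)
  have hBd (s : ℝ) : HasDerivAt (fun r => B s r) (deriv (fun r => B s r) τ) τ := by
    have h : ContDiff ℝ 1 fun r => B s r := hB.comp (contDiff_const.prodMk contDiff_id)
    exact (h.differentiable one_ne_zero τ).hasDerivAt
  have key : HasDerivAt
      (fun τ' => ∫ s in (0 : ℝ)..1, Ring.inverse (f s τ) * (B s τ' - B s τ) * f s τ')
      (∫ s in (0 : ℝ)..1, Ring.inverse (f s τ) * deriv (fun r => B s r) τ * f s τ) τ := by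
    rw [hasDerivAt_iff_tendsto_slope]
    have hslope : slope (fun τ' => ∫ s in (0 : ℝ)..1,
          Ring.inverse (f s τ) * (B s τ' - B s τ) * f s τ') τ =
        fun τ' => ∫ s in (0 : ℝ)..1,
          Ring.inverse (f s τ) * slope (fun r => B s r) τ τ' * f s τ' := by
      ext τ'
      simp [slope_def_module, ← intervalIntegral.integral_smul]
    rw [hslope]
    refine intervalIntegral.tendsto_integral_filter_of_dominated_convergence
      (fun s => ‖Ring.inverse (f s τ)‖ * L * M) (.of_forall fun τ' => ?_) ?_
      ((hinv.norm.mul_const L).mul_const M |>.intervalIntegrable 0 1) (.of_forall fun s hs => ?_)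
    · simp only [slope_def_module]
      exact ((hinv.mul (((hBc τ').sub (hBc τ)).const_smul _)).mul
        (hcont τ')).aestronglyMeasurable
    · filter_upwards [nhdsWithin_le_nhds (Metric.closedBall_mem_nhds τ one_pos),
        self_mem_nhdsWithin] with τ' hτ' hne
      refine .of_forall fun s hs => ?_
      rw [uIoc_of_le zero_le_one] at hs
      replace hs := Ioc_subset_Icc_self hs
      have hpos : 0 < |τ' - τ| := abs_pos.2 (sub_ne_zero.2 hne)
      have hsl : ‖slope (fun r => B s r) τ τ'‖ ≤ L := by
        rw [slope_def_module, norm_smul, norm_inv, Real.norm_eq_abs, inv_mul_le_iff₀ hpos,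
          mul_comm]
        exact (hKL s hs τ' hτ').2
      exact (norm_mul_le _ _).trans (mul_le_mul ((norm_mul_le _ _).trans
        (mul_le_mul_of_nonneg_left hsl (norm_nonneg _))) (hM s hs τ' hτ') (norm_nonneg _)
        (by positivity))
    · rw [uIoc_of_le zero_le_one] at hs
      exact ((hasDerivAt_iff_tendsto_slope.1 (hBd s)).const_mul _).mul
        ((continuousAt_linearODE_parameter hB hf hf0 (Ioc_subset_Icc_self hs) τ).mono_left
          nhdsWithin_le_nhds)
  have hfun : (fun τ' => f 1 τ') = fun τ' => f 1 τ *
      (1 + ∫ s in (0 : ℝ)..1, Ring.inverse (f s τ) * (B s τ' - B s τ) * f s τ') :=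
    funext fun τ' => linearODE_parameter_eq_mul_integral hB hf hf0 hu τ τ'
  rw [hfun]
  exact ((key.const_add 1).const_mul (f 1 τ)).differentiableAt

end ParametricLinearODE

/-- For the Wilson loop operator `W = T⁻¹ Q P`, the τ-derivative exists and satisfies
`∂_τ W * W⁻¹ = T⁻¹ (A₀ - (∂_τ T) T⁻¹) T`. -/
theorem wilson_loop_L_deriv
    (n : ℕ) (hn : 1 ≤ n)
    (A₀ A₁ : ℝ → ℝ → Matrix (Fin n) (Fin n) ℂ)
    (hA₀ : ContDiff ℝ 1 fun p : ℝ × ℝ => A₀ p.1 p.2)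
    (hA₁ : ContDiff ℝ 1 fun p : ℝ × ℝ => A₁ p.1 p.2)
    (σ₀ τ₀ : ℝ)
    (P Q : ℝ → ℝ → Matrix (Fin n) (Fin n) ℂ)
    (hP : ∀ (σ τ : ℝ), HasDerivAt (fun σ' : ℝ => P σ' τ) (A₁ σ τ * P σ τ) σ)
    (hP0 : ∀ τ : ℝ, P σ₀ τ = 1)
    (hPinv : ∀ (σ τ : ℝ), IsUnit (P σ τ))
    (hQ : ∀ (σ τ : ℝ), HasDerivAt (fun τ' : ℝ => Q σ τ') (A₀ σ τ * Q σ τ) τ)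
    (hQ0 : ∀ σ : ℝ, Q σ τ₀ = 1)
    (hQinv : ∀ (σ τ : ℝ), IsUnit (Q σ τ))
    (T : ℝ → ℝ → Matrix (Fin n) (Fin n) ℂ)
    (hT : ∀ (σ τ : ℝ), T σ τ = P σ τ * Q σ₀ τ)
    (W : ℝ → ℝ → Matrix (Fin n) (Fin n) ℂ)
    (hW : ∀ (σ τ : ℝ), W σ τ = (T σ τ)⁻¹ * Q σ τ * P σ τ₀) :
    ∀ (σ τ : ℝ),
      DifferentiableAt ℝ (fun τ' : ℝ => W σ τ') τ ∧
      deriv (fun τ' : ℝ => W σ τ') τ * (W σ τ)⁻¹ =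
        (T σ τ)⁻¹ *
          (A₀ σ τ - deriv (fun τ' : ℝ => T σ τ') τ * (T σ τ)⁻¹) * T σ τ := by
  intro σ τ
  have hcomplete : CompleteSpace (Matrix (Fin n) (Fin n) ℂ) := FiniteDimensional.complete ℝ _
  have hPd : DifferentiableAt ℝ (fun τ' => P σ τ') τ := by
    have h := differentiableAt_linearODE_parameter
      (B := fun t r => (σ - σ₀) • A₁ (σ₀ + t * (σ - σ₀)) r)
      (f := fun t r => P (σ₀ + t * (σ - σ₀)) r)
      ((hA₁.comp (f := fun p : ℝ × ℝ => (σ₀ + p.1 * (σ - σ₀), p.2))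
        (by fun_prop)).const_smul (σ - σ₀))
      (fun t r => by
        have hlin : HasDerivAt (fun t : ℝ => σ₀ + t * (σ - σ₀)) (σ - σ₀) t := by
          simpa using ((hasDerivAt_id t).mul_const (σ - σ₀)).const_add σ₀
        rw [smul_mul_assoc]
        exact (hP (σ₀ + t * (σ - σ₀)) r).scomp t hlin)
      (fun r => by simp [hP0]) (fun _ _ => hPinv _ _) τ
    simp only [one_mul, add_sub_cancel] at h
    exact h
  have hTu : IsUnit (T σ τ) := by rw [hT]; exact (hPinv _ _).mul (hQinv _ _)
  have hTd : HasDerivAt (fun τ' => T σ τ') (deriv (fun τ' => T σ τ') τ) τ := by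
    have h := (hPd.hasDerivAt.mul (hQ σ₀ τ)).differentiableAt
    have hfun : (fun τ' => T σ τ') = (fun τ' => P σ τ') * fun τ' => Q σ₀ τ' :=
      funext fun τ' => hT σ τ'
    rw [hfun]
    exact h.hasDerivAt
  have hWd := ((hTd.ringInverse hTu).mul (hQ σ τ)).mul_const (P σ τ₀)
  have hWd' := hWd.congr_of_eventuallyEq (f₁ := fun τ' => W σ τ')
    (.of_forall fun τ' => by simp [hW, Matrix.nonsing_inv_eq_ringInverse])
  have hderiv : deriv (fun τ' => W σ τ') τ =
      (T σ τ)⁻¹ * (A₀ σ τ - deriv (fun τ' => T σ τ') τ * (T σ τ)⁻¹) * (Q σ τ * P σ τ₀) := by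
    refine hWd'.deriv.trans ?_
    rw [← Matrix.nonsing_inv_eq_ringInverse]
    noncomm_ring
  have hTdet := (Matrix.isUnit_iff_isUnit_det _).1 hTu
  have hQPdet := (Matrix.isUnit_iff_isUnit_det _).1 ((hQinv σ τ).mul (hPinv σ τ₀))
  refine ⟨hWd'.differentiableAt, ?_⟩
  rw [hderiv, hW, mul_assoc (T σ τ)⁻¹ (Q σ τ), Matrix.mul_inv_rev,
    Matrix.nonsing_inv_nonsing_inv _ hTdet, ← mul_assoc,
    Matrix.mul_nonsing_inv_cancel_right _ _ hQPdet]
end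

section
/- With the Wilson-loop setup below, fix τ ∈ ℝ. Then the function σ ↦ T(σ, τ)⁻¹ * (A₀(σ, τ) − ∂_τ T(σ, τ) * T(σ, τ)⁻¹) * T(σ, τ) is differentiable in σ, and its derivative at σ equals T(σ, τ)⁻¹ * F₀₁(σ, τ) * T(σ, τ), where F₀₁(σ, τ) = ∂_σ A₀(σ, τ) − ∂_τ A₁(σ, τ) + A₀(σ, τ) * A₁(σ, τ) − A₁(σ, τ) * A₀(σ, τ). -/
open Filter Topology MeasureTheory Set

section NormedRing

variable {E : Type*} [NormedRing E] [NormedAlgebra ℝ E] [CompleteSpace E]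

theorem eq_one_add_integral {B N : ℝ → E} {a : ℝ}
    (hB : Continuous B) (hN : ∀ s, HasDerivAt N (B s * N s) s) (hNa : N a = 1) (b : ℝ) :
    N b = 1 + ∫ s in a..b, B s * N s := by
  have hNc : Continuous N := continuous_iff_continuousAt.2 fun s => (hN s).continuousAt
  rw [intervalIntegral.integral_eq_sub_of_hasDerivAt (fun s _ => hN s)
    ((hB.mul hNc).intervalIntegrable _ _), hNa]
  abel

theorem norm_le_two_mul_norm_one {B N : ℝ → E} {a b ε : ℝ}
    (hB : Continuous B) (hN : ∀ s, HasDerivAt N (B s * N s) s) (hNa : N a = 1)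
    (hε : ∀ s ∈ uIcc a b, ‖B s‖ ≤ ε) (hε' : ε * |b - a| ≤ 1 / 2) :
    ∀ s ∈ uIcc a b, ‖N s‖ ≤ 2 * ‖(1 : E)‖ := by
  have hNc : Continuous N := continuous_iff_continuousAt.2 fun s => (hN s).continuousAt
  obtain ⟨m, hm, hmax⟩ := isCompact_uIcc.exists_isMaxOn ⟨a, left_mem_uIcc⟩
    (hNc.norm.continuousOn (s := uIcc a b))
  have hε0 : 0 ≤ ε := (norm_nonneg _).trans (hε a left_mem_uIcc)
  have h1 : ‖∫ s in a..m, B s * N s‖ ≤ ε * ‖N m‖ * |m - a| := by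
    refine intervalIntegral.norm_integral_le_of_norm_le_const fun s hs => ?_
    have hs' : s ∈ uIcc a b := uIcc_subset_uIcc_left hm (uIoc_subset_uIcc hs)
    exact (norm_mul_le _ _).trans
      (mul_le_mul (hε s hs') (hmax hs') (norm_nonneg _) hε0)
  have h2 : ‖N m‖ ≤ ‖(1 : E)‖ + ‖∫ s in a..m, B s * N s‖ := by
    conv_lhs => rw [eq_one_add_integral hB hN hNa m]
    exact norm_add_le _ _
  have h3 : |m - a| ≤ |b - a| := abs_sub_left_of_mem_uIcc hm
  intro s hs
  have h4 : ‖N s‖ ≤ ‖N m‖ := hmax hs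
  have h5 : ε * ‖N m‖ * |m - a| ≤ 1 / 2 * ‖N m‖ := by
    calc ε * ‖N m‖ * |m - a| ≤ ε * ‖N m‖ * |b - a| := by gcongr
      _ = ε * |b - a| * ‖N m‖ := by ring
      _ ≤ _ := by gcongr
  linarith

/-- Solutions of `∂_s N = B N`, `N a = 1` are differentiable in the parameter at a point where `B`
vanishes. -/
theorem hasDerivAt_of_linear_ode_param {B N : ℝ → ℝ → E} {B' : ℝ → E} {a b τ L : ℝ}
    (hB : ∀ t, Continuous fun s => B s t)
    (hN : ∀ s t, HasDerivAt (fun s => N s t) (B s t * N s t) s) (hNa : ∀ t, N a t = 1)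
    (hL : ∀ᶠ t in 𝓝 τ, ∀ s ∈ uIcc a b, ‖B s t‖ ≤ L * |t - τ|)
    (hB' : ∀ s, HasDerivAt (B s) (B' s) τ) :
    HasDerivAt (N b) (∫ s in a..b, B' s) τ := by
  have hB0 : ∀ s ∈ uIcc a b, B s τ = 0 := fun s hs => by
    simpa using hL.self_of_nhds s hs
  have hN1 : ∀ s ∈ uIcc a b, N s τ = 1 := fun s hs => by
    rw [eq_one_add_integral (hB τ) (fun s => hN s τ) (hNa τ) s]
    rw [intervalIntegral.integral_congr (g := fun _ => 0)]
    · simp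
    · intro r hr
      simp [hB0 r (uIcc_subset_uIcc_left hs hr)]
  have hlim (c : ℝ) : Tendsto (fun t => L * |t - τ| * c) (𝓝 τ) (𝓝 0) := by
    have : Continuous fun t => L * |t - τ| * c := by fun_prop
    simpa using this.tendsto τ
  have hsmall : ∀ᶠ t in 𝓝 τ, L * |t - τ| * |b - a| ≤ 1 / 2 :=
    (hlim _).eventually (eventually_le_nhds (by norm_num))
  have hbound : ∀ᶠ t in 𝓝 τ, ∀ s ∈ uIcc a b, ‖N s t‖ ≤ 2 * ‖(1 : E)‖ := by
    filter_upwards [hL, hsmall] with t ht ht'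
    exact norm_le_two_mul_norm_one (hB t) (fun s => hN s t) (hNa t) ht ht'
  have hN_tendsto : ∀ s ∈ uIcc a b, Tendsto (N s) (𝓝 τ) (𝓝 1) := fun s hs => by
    rw [tendsto_iff_norm_sub_tendsto_zero]
    refine squeeze_zero' (.of_forall fun _ => norm_nonneg _) ?_
      (hlim (2 * ‖(1 : E)‖ * |s - a|))
    filter_upwards [hL, hbound] with t ht ht'
    rw [eq_one_add_integral (hB t) (fun s => hN s t) (hNa t) s, add_sub_cancel_left, ← mul_assoc]
    refine intervalIntegral.norm_integral_le_of_norm_le_const fun r hr => ?_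
    have hr' : r ∈ uIcc a b := uIcc_subset_uIcc_left hs (uIoc_subset_uIcc hr)
    exact (norm_mul_le _ _).trans (mul_le_mul (ht r hr') (ht' r hr') (norm_nonneg _)
      ((norm_nonneg _).trans (ht r hr')))
  have hslope : slope (N b) τ = fun t => ∫ s in a..b, slope (B s) τ t * N s t := by
    funext t
    rw [slope_def_module, hN1 b right_mem_uIcc,
      eq_one_add_integral (hB t) (fun s => hN s t) (hNa t) b, add_sub_cancel_left,
      ← intervalIntegral.integral_smul]
    refine intervalIntegral.integral_congr fun s hs => ?_
    simp [slope_def_module, hB0 s hs]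
  rw [hasDerivAt_iff_tendsto_slope, hslope]
  refine intervalIntegral.tendsto_integral_filter_of_dominated_convergence
    (fun _ => L * (2 * ‖(1 : E)‖)) (.of_forall fun t => ?_) ?_ (by simp) ?_
  · have hNc : Continuous fun s => N s t :=
      continuous_iff_continuousAt.2 fun s => (hN s t).continuousAt
    simp only [slope_def_module]
    have h1 := hB t
    have h2 := hB τ
    exact Continuous.aestronglyMeasurable (by fun_prop)
  · filter_upwards [hL.filter_mono nhdsWithin_le_nhds, hbound.filter_mono nhdsWithin_le_nhds,
      self_mem_nhdsWithin] with t ht ht' hne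
    refine .of_forall fun s hs => ?_
    have hs' := uIoc_subset_uIcc hs
    have hpos : 0 < |t - τ| := abs_pos.2 (sub_ne_zero.2 hne)
    have h1 : ‖slope (B s) τ t‖ ≤ L := by
      rw [slope_def_module, hB0 s hs', sub_zero, norm_smul, norm_inv, Real.norm_eq_abs,
        inv_mul_le_iff₀ hpos, mul_comm]
      exact ht s hs'
    exact (norm_mul_le _ _).trans
      (mul_le_mul h1 (ht' s hs') (norm_nonneg _) ((norm_nonneg _).trans h1))
  · refine .of_forall fun s hs => ?_
    have := (hasDerivAt_iff_tendsto_slope.1 (hB' s)).mul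
      ((hN_tendsto s (uIoc_subset_uIcc hs)).mono_left nhdsWithin_le_nhds)
    simpa using this

theorem hasDerivAt_ringInverse_of_linear_ode {P : ℝ → E} {A : E} {s : ℝ}
    (hP : HasDerivAt P (A * P s) s) (hu : IsUnit (P s)) :
    HasDerivAt (fun r => Ring.inverse (P r)) (-(Ring.inverse (P s) * A)) s := by
  obtain ⟨u, hu⟩ := hu
  have h := (hu ▸ hasFDerivAt_ringInverse (𝕜 := ℝ) u).comp_hasDerivAt s hP
  refine h.congr_deriv ?_
  simp [← hu, mul_assoc]

section ContDiff

variable {F : Type*} [NormedAddCommGroup F] [NormedSpace ℝ F] {A : ℝ → ℝ → F}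

theorem hasDerivAt_left_of_contDiff (hA : ContDiff ℝ 1 fun p : ℝ × ℝ => A p.1 p.2) (s t : ℝ) :
    HasDerivAt (fun s => A s t) (deriv (fun s => A s t) s) s := by
  have h : ContDiff ℝ 1 fun s => A s t :=
    hA.comp (contDiff_id.prodMk contDiff_const)
  exact (h.differentiable one_ne_zero s).hasDerivAt

theorem hasDerivAt_right_of_contDiff (hA : ContDiff ℝ 1 fun p : ℝ × ℝ => A p.1 p.2) (s t : ℝ) :
    HasDerivAt (A s) (deriv (A s) t) t := by
  have h : ContDiff ℝ 1 (A s) := hA.comp (contDiff_const.prodMk contDiff_id)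
  exact (h.differentiable one_ne_zero t).hasDerivAt

theorem continuous_deriv_right_of_contDiff (hA : ContDiff ℝ 1 fun p : ℝ × ℝ => A p.1 p.2)
    (t : ℝ) : Continuous fun s => deriv (A s) t := by
  have h : ∀ s, deriv (A s) t = fderiv ℝ (fun p : ℝ × ℝ => A p.1 p.2) (s, t) (0, 1) := fun s =>
    ((hA.differentiable one_ne_zero (s, t)).hasFDerivAt.comp_hasDerivAt t
      ((hasDerivAt_const t s).prodMk (hasDerivAt_id t))).deriv
  simp_rw [h]
  have := hA.continuous_fderiv one_ne_zero
  fun_prop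

theorem exists_norm_sub_le_of_contDiff (hA : ContDiff ℝ 1 fun p : ℝ × ℝ => A p.1 p.2)
    (a b τ : ℝ) :
    ∃ K : ℝ, ∀ᶠ t in 𝓝 τ, ∀ s ∈ uIcc a b, ‖A s t - A s τ‖ ≤ K * |t - τ| := by
  obtain ⟨K, hK⟩ := hA.contDiffOn.exists_lipschitzOnWith one_ne_zero
    ((convex_uIcc a b).prod (convex_Icc (τ - 1) (τ + 1))) (isCompact_uIcc.prod isCompact_Icc)
  refine ⟨K, ?_⟩
  filter_upwards [Icc_mem_nhds (by linarith : τ - 1 < τ) (by linarith : τ < τ + 1)] with t ht s hs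
  have h := hK.norm_sub_le (x := (s, t)) ⟨hs, ht⟩ (y := (s, τ)) ⟨hs, by simp⟩
  simpa using h

end ContDiff

/-- Duhamel's formula for the derivative of a parallel transport with respect to a parameter. -/
theorem hasDerivAt_parallel_transport_param {A P : ℝ → ℝ → E} {a : ℝ}
    (hA : ContDiff ℝ 1 fun p : ℝ × ℝ => A p.1 p.2)
    (hP : ∀ s t, HasDerivAt (fun s => P s t) (A s t * P s t) s) (hPa : ∀ t, P a t = 1)
    (hu : ∀ s t, IsUnit (P s t)) (b τ : ℝ) :
    HasDerivAt (P b)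
      (P b τ * ∫ s in a..b, Ring.inverse (P s τ) * deriv (A s) τ * P s τ) τ := by
  have hR s := hasDerivAt_ringInverse_of_linear_ode (hP s τ) (hu s τ)
  have hRc : Continuous fun s => Ring.inverse (P s τ) :=
    continuous_iff_continuousAt.2 fun s => (hR s).continuousAt
  have hPc : Continuous fun s => P s τ :=
    continuous_iff_continuousAt.2 fun s => (hP s τ).continuousAt
  have hAc t : Continuous fun s => A s t :=
    hA.continuous.comp (continuous_id.prodMk continuous_const)
  obtain ⟨K, hK⟩ := exists_norm_sub_le_of_contDiff hA a b τ
  obtain ⟨C, hC⟩ := isCompact_uIcc.exists_bound_of_continuousOn (hRc.continuousOn (s := uIcc a b))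
  obtain ⟨D, hD⟩ := isCompact_uIcc.exists_bound_of_continuousOn (hPc.continuousOn (s := uIcc a b))
  have key : HasDerivAt (fun t => Ring.inverse (P b τ) * P b t)
      (∫ s in a..b, Ring.inverse (P s τ) * deriv (A s) τ * P s τ) τ := by
    refine hasDerivAt_of_linear_ode_param (a := a) (L := C * K * D)
      (B := fun s t => Ring.inverse (P s τ) * (A s t - A s τ) * P s τ)
      (N := fun s t => Ring.inverse (P s τ) * P s t)
      (fun t => (hRc.mul ((hAc t).sub (hAc τ))).mul hPc) (fun s t => ?_) (by simp [hPa]) ?_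
      (fun s => (((hasDerivAt_right_of_contDiff hA s τ).sub_const _).const_mul _).mul_const _)
    · refine ((hR s).mul (hP s t)).congr_deriv ?_
      have : Ring.inverse (P s τ) * (A s t - A s τ) * P s τ * (Ring.inverse (P s τ) * P s t)
          = Ring.inverse (P s τ) * (A s t - A s τ) * (P s τ * Ring.inverse (P s τ)) * P s t := by
        noncomm_ring
      rw [this, Ring.mul_inverse_cancel _ (hu s τ)]
      noncomm_ring
    · filter_upwards [hK] with t ht s hs
      have hC0 := (norm_nonneg _).trans (hC s hs)
      calc ‖Ring.inverse (P s τ) * (A s t - A s τ) * P s τ‖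
          ≤ ‖Ring.inverse (P s τ)‖ * ‖A s t - A s τ‖ * ‖P s τ‖ := norm_mul₃_le
        _ ≤ C * (K * |t - τ|) * D := by
          have h0 := (norm_nonneg _).trans (ht s hs)
          gcongr
          exacts [hC s hs, ht s hs, hD s hs]
        _ = C * K * D * |t - τ| := by ring
  have h := key.const_mul (P b τ)
  simpa only [← mul_assoc, Ring.mul_inverse_cancel _ (hu b τ), one_mul] using h

/-- The Wilson line identity in an arbitrary real Banach algebra. -/
theorem hasDerivAt_wilson_integrand {A₀ A₁ P T : ℝ → ℝ → E} {q : ℝ → E} {σ₀ : ℝ}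
    (hA₀ : ContDiff ℝ 1 fun p : ℝ × ℝ => A₀ p.1 p.2)
    (hA₁ : ContDiff ℝ 1 fun p : ℝ × ℝ => A₁ p.1 p.2)
    (hP : ∀ σ τ, HasDerivAt (fun σ' => P σ' τ) (A₁ σ τ * P σ τ) σ) (hP0 : ∀ τ, P σ₀ τ = 1)
    (hPu : ∀ σ τ, IsUnit (P σ τ)) (hq : ∀ τ, HasDerivAt q (A₀ σ₀ τ * q τ) τ)
    (hqu : ∀ τ, IsUnit (q τ)) (hT : ∀ σ τ, T σ τ = P σ τ * q τ) (τ σ : ℝ) :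
    HasDerivAt
      (fun σ' => Ring.inverse (T σ' τ) *
        (A₀ σ' τ - deriv (fun t => T σ' t) τ * Ring.inverse (T σ' τ)) * T σ' τ)
      (Ring.inverse (T σ τ) *
        (deriv (fun σ' => A₀ σ' τ) σ - deriv (fun τ' => A₁ σ τ') τ +
          (A₀ σ τ * A₁ σ τ - A₁ σ τ * A₀ σ τ)) * T σ τ) σ := by
  let J : ℝ → E := fun σ' =>
    ∫ s in σ₀..σ', Ring.inverse (P s τ) * deriv (A₁ s) τ * P s τ
  have hR s := hasDerivAt_ringInverse_of_linear_ode (hP s τ) (hPu s τ)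
  have hRc : Continuous fun s => Ring.inverse (P s τ) :=
    continuous_iff_continuousAt.2 fun s => (hR s).continuousAt
  have hPc : Continuous fun s => P s τ :=
    continuous_iff_continuousAt.2 fun s => (hP s τ).continuousAt
  have hJ' : HasDerivAt J (Ring.inverse (P σ τ) * deriv (A₁ σ) τ * P σ τ) σ :=
    (((hRc.mul (continuous_deriv_right_of_contDiff hA₁ τ)).mul hPc).integral_hasStrictDerivAt
      σ₀ σ).hasDerivAt
  have hTinv : ∀ s, Ring.inverse (T s τ) = Ring.inverse (q τ) * Ring.inverse (P s τ) := fun s => by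
    rw [hT]
    obtain ⟨u, hu⟩ := hPu s τ
    obtain ⟨v, hv⟩ := hqu τ
    rw [← hu, ← hv, ← Units.val_mul]
    simp only [Ring.inverse_unit, mul_inv_rev]
    rw [Units.val_mul]
  have hPd s : HasDerivAt (P s) (P s τ * J s) τ :=
    hasDerivAt_parallel_transport_param hA₁ hP hP0 hPu s τ
  have hTd : ∀ s, deriv (fun t => T s t) τ = P s τ * (J s + A₀ σ₀ τ) * q τ := fun s => by
    simp_rw [hT]
    rw [((hPd s).fun_mul (hq τ)).deriv]
    noncomm_ring
  have hfun : (fun s => Ring.inverse (T s τ) *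
        (A₀ s τ - deriv (fun t => T s t) τ * Ring.inverse (T s τ)) * T s τ) =
      fun s => Ring.inverse (q τ) *
        (Ring.inverse (P s τ) * A₀ s τ * P s τ - (J s + A₀ σ₀ τ)) * q τ := by
    funext s
    have hTT : Ring.inverse (T s τ) * T s τ = 1 :=
      Ring.inverse_mul_cancel _ (hT s τ ▸ (hPu s τ).mul (hqu τ))
    rw [mul_assoc, sub_mul, mul_assoc (deriv _ _), hTT, mul_one, mul_sub, hTd, hTinv, hT]
    have hPP := Ring.inverse_mul_cancel _ (hPu s τ)
    rw [show Ring.inverse (q τ) * Ring.inverse (P s τ) * (P s τ * (J s + A₀ σ₀ τ) * q τ) =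
      Ring.inverse (q τ) * (Ring.inverse (P s τ) * P s τ) * ((J s + A₀ σ₀ τ) * q τ) by
        noncomm_ring, hPP]
    noncomm_ring
  rw [hfun]
  refine ((((((hR σ).fun_mul (hasDerivAt_left_of_contDiff hA₀ σ τ)).fun_mul (hP σ τ)).fun_sub
    (hJ'.add_const (A₀ σ₀ τ))).const_mul _).mul_const _).congr_deriv ?_
  rw [hTinv, hT]
  noncomm_ring

end NormedRing

attribute [local instance] Matrix.linftyOpNormedAddCommGroup Matrix.linftyOpNormedRing
  Matrix.linftyOpNormedSpace Matrix.linftyOpNormedAlgebra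

/-- The σ-derivative of `T⁻¹ (A₀ - (∂_τ T) T⁻¹) T` is `T⁻¹ F₀₁ T`, where
`F₀₁ = ∂_σ A₀ − ∂_τ A₁ + [A₀, A₁]`. -/
theorem wilson_integrand_deriv
    (n : ℕ) (hn : 1 ≤ n)
    (A₀ A₁ : ℝ → ℝ → Matrix (Fin n) (Fin n) ℂ)
    (hA₀ : ContDiff ℝ 1 fun p : ℝ × ℝ => A₀ p.1 p.2)
    (hA₁ : ContDiff ℝ 1 fun p : ℝ × ℝ => A₁ p.1 p.2)
    (σ₀ τ₀ : ℝ)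
    (P Q : ℝ → ℝ → Matrix (Fin n) (Fin n) ℂ)
    (hP : ∀ (σ τ : ℝ), HasDerivAt (fun σ' : ℝ => P σ' τ) (A₁ σ τ * P σ τ) σ)
    (hP0 : ∀ τ : ℝ, P σ₀ τ = 1)
    (hPinv : ∀ (σ τ : ℝ), IsUnit (P σ τ))
    (hQ : ∀ (σ τ : ℝ), HasDerivAt (fun τ' : ℝ => Q σ τ') (A₀ σ τ * Q σ τ) τ)
    (hQ0 : ∀ σ : ℝ, Q σ τ₀ = 1)
    (hQinv : ∀ (σ τ : ℝ), IsUnit (Q σ τ))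
    (T : ℝ → ℝ → Matrix (Fin n) (Fin n) ℂ)
    (hT : ∀ (σ τ : ℝ), T σ τ = P σ τ * Q σ₀ τ)
    (τ : ℝ) :
    ∀ σ : ℝ,
      HasDerivAt
        (fun σ' : ℝ =>
          (T σ' τ)⁻¹ * (A₀ σ' τ - deriv (fun t : ℝ => T σ' t) τ * (T σ' τ)⁻¹) * T σ' τ)
        ((T σ τ)⁻¹ *
          (deriv (fun σ' : ℝ => A₀ σ' τ) σ - deriv (fun τ' : ℝ => A₁ σ τ') τ +
            (A₀ σ τ * A₁ σ τ - A₁ σ τ * A₀ σ τ)) * T σ τ) σ := by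
  intro σ
  simp only [Matrix.nonsing_inv_eq_ringInverse]
  exact hasDerivAt_wilson_integrand (q := Q σ₀) hA₀ hA₁ hP hP0 hPinv (hQ σ₀) (hQinv σ₀) hT τ σ
end

section
/- With the Wilson-loop setup below, for all σ, τ ∈ ℝ: T(σ, τ)⁻¹ * (∂_τ P(σ, σ₀; τ)) * P(σ, σ₀; τ)⁻¹ * T(σ, τ) = ∫_{σ₀}^{σ} T(σ', τ)⁻¹ * ∂_τ A₁(σ', τ) * T(σ', τ) dσ'. -/
attribute [local instance] Matrix.linftyOpNormedAddCommGroup Matrix.linftyOpNormedRing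
  Matrix.linftyOpNormedSpace Matrix.linftyOpNormedAlgebra

open Set Filter Topology MeasureTheory

section LinearODE

variable {R : Type*} [NormedRing R] [NormedAlgebra ℝ R]

theorem HasDerivAt.ringInverse_of_isUnit [CompleteSpace R] {f : ℝ → R} {f' : R} {s : ℝ}
    (hf : HasDerivAt f f' s) (hu : IsUnit (f s)) :
    HasDerivAt (fun t => Ring.inverse (f t))
      (-(Ring.inverse (f s) * f' * Ring.inverse (f s))) s := by
  obtain ⟨u, hu⟩ := hu
  have h := hasFDerivAt_ringInverse (𝕜 := ℝ) u
  rw [hu] at h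
  exact (h.comp_hasDerivAt s hf).congr_deriv (by simp [← hu])

theorem norm_le_of_hasDerivAt_mul_of_le {a f : ℝ → R} {s₀ s K : ℝ} (hs : s₀ ≤ s)
    (hf : ∀ t, HasDerivAt f (a t * f t) t) (ha : ∀ t ∈ Icc s₀ s, ‖a t‖ ≤ K) :
    ‖f s‖ ≤ ‖f s₀‖ * Real.exp (K * (s - s₀)) := by
  rw [← gronwallBound_ε0]
  refine norm_le_gronwallBound_of_norm_deriv_right_le (f' := fun t => a t * f t)
    (fun t _ => (hf t).continuousAt.continuousWithinAt)
    (fun t _ => (hf t).hasDerivWithinAt) le_rfl (fun t ht => ?_) s (right_mem_Icc.2 hs)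
  rw [add_zero]
  exact (norm_mul_le _ _).trans (by gcongr; exact ha t (Ico_subset_Icc_self ht))

theorem norm_le_of_hasDerivAt_mul {a f : ℝ → R} {s₀ s K : ℝ}
    (hf : ∀ t, HasDerivAt f (a t * f t) t) (ha : ∀ t ∈ uIcc s₀ s, ‖a t‖ ≤ K) :
    ‖f s‖ ≤ ‖f s₀‖ * Real.exp (K * |s - s₀|) := by
  rcases le_total s₀ s with hs | hs
  · rw [uIcc_of_le hs] at ha
    rw [abs_of_nonneg (sub_nonneg.2 hs)]
    exact norm_le_of_hasDerivAt_mul_of_le hs hf ha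
  · rw [uIcc_of_ge hs] at ha
    rw [abs_of_nonpos (sub_nonpos.2 hs)]
    have h := norm_le_of_hasDerivAt_mul_of_le (a := fun t => -a (-t)) (f := fun t => f (-t))
      (K := K) (neg_le_neg hs)
      (fun t => by
        have h := (hf (-t)).scomp t (hasDerivAt_neg t)
        simpa [Function.comp_def] using h)
      (fun t ht => by
        rw [norm_neg]
        exact ha _ ⟨by linarith [ht.2], by linarith [ht.1]⟩)
    simp only [neg_neg] at h
    convert h using 3
    ring

theorem inverse_mul_sub_inverse_mul_eq_integral [CompleteSpace R] {a b f g : ℝ → R}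
    (ha : Continuous a) (hb : Continuous b)
    (hf : ∀ t, HasDerivAt f (a t * f t) t) (hg : ∀ t, HasDerivAt g (b t * g t) t)
    (hu : ∀ t, IsUnit (f t)) (s₀ s : ℝ) :
    ∫ t in s₀..s, Ring.inverse (f t) * (b t - a t) * g t =
      Ring.inverse (f s) * g s - Ring.inverse (f s₀) * g s₀ := by
  have hi : ∀ t, HasDerivAt (fun t => Ring.inverse (f t)) (-(Ring.inverse (f t) * a t)) t := by
    intro t
    have h := (hf t).ringInverse_of_isUnit (hu t)
    rwa [mul_assoc, mul_assoc, Ring.mul_inverse_cancel _ (hu t), mul_one] at h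
  have hic : Continuous fun t => Ring.inverse (f t) :=
    continuous_iff_continuousAt.2 fun t => (hi t).continuousAt
  have hgc : Continuous g := continuous_iff_continuousAt.2 fun t => (hg t).continuousAt
  refine intervalIntegral.integral_eq_sub_of_hasDerivAt
    (f := fun t => Ring.inverse (f t) * g t) (fun t _ => ?_)
    (((hic.mul (hb.sub ha)).mul hgc).intervalIntegrable _ _)
  exact ((hi t).mul (hg t)).congr_deriv (by noncomm_ring)

theorem hasDerivAt_snd_of_contDiff {A : ℝ → ℝ → R} (hA : ContDiff ℝ 1 fun p : ℝ × ℝ => A p.1 p.2)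
    (s x : ℝ) :
    HasDerivAt (A s) (fderiv ℝ (fun p : ℝ × ℝ => A p.1 p.2) (s, x) (0, 1)) x := by
  have h := (hA.differentiable one_ne_zero (s, x)).hasFDerivAt
  exact h.comp_hasDerivAt x ((hasDerivAt_const x s).prodMk (hasDerivAt_id x))

theorem continuous_deriv_snd_of_contDiff {A : ℝ → ℝ → R}
    (hA : ContDiff ℝ 1 fun p : ℝ × ℝ => A p.1 p.2) :
    Continuous fun p : ℝ × ℝ => deriv (A p.1) p.2 := by
  simp only [fun s x => (hasDerivAt_snd_of_contDiff hA s x).deriv]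
  exact (hA.continuous_fderiv one_ne_zero).clm_apply continuous_const

/-- Derivative of the fundamental solution of a linear ODE with respect to a parameter. -/
theorem hasDerivAt_param_of_linear_ode [CompleteSpace R] {A P : ℝ → ℝ → R} {s₀ : ℝ}
    (hA : ContDiff ℝ 1 fun p : ℝ × ℝ => A p.1 p.2)
    (hP : ∀ s x, HasDerivAt (fun t => P t x) (A s x * P s x) s)
    (hP0 : ∀ x, P s₀ x = 1) (hu : ∀ s x, IsUnit (P s x)) (s x : ℝ) :
    HasDerivAt (P s)
      (P s x * ∫ t in s₀..s, Ring.inverse (P t x) * deriv (A t) x * P t x) x := by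
  have hAc : ∀ y, Continuous fun t => A t y := fun y =>
    hA.continuous.comp (continuous_id.prodMk continuous_const)
  have hPc : ∀ y, Continuous fun t => P t y := fun y =>
    continuous_iff_continuousAt.2 fun t => (hP t y).continuousAt
  have hic : Continuous fun t => Ring.inverse (P t x) :=
    continuous_iff_continuousAt.2 fun t => ((hP t x).ringInverse_of_isUnit (hu t x)).continuousAt
  have hK : IsCompact (uIcc s₀ s ×ˢ Icc (x - 1) (x + 1)) := isCompact_uIcc.prod isCompact_Icc
  obtain ⟨K, hK1⟩ := hK.exists_bound_of_continuousOn hA.continuous.continuousOn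
  obtain ⟨C, hC⟩ := hK.exists_bound_of_continuousOn
    (continuous_deriv_snd_of_contDiff hA).continuousOn
  obtain ⟨M, hM⟩ := (isCompact_uIcc (a := s₀) (b := s)).exists_bound_of_continuousOn hic.continuousOn
  have hxI : x ∈ Icc (x - 1) (x + 1) := ⟨by linarith, by linarith⟩
  have hnhds : Icc (x - 1) (x + 1) ∈ 𝓝 x := Icc_mem_nhds (by linarith) (by linarith)
  have hK0 : 0 ≤ K := (norm_nonneg _).trans (hK1 (s, x) ⟨right_mem_uIcc, hxI⟩)
  have hC0 : 0 ≤ C := (norm_nonneg _).trans (hC (s, x) ⟨right_mem_uIcc, hxI⟩)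
  have hM0 : 0 ≤ M := (norm_nonneg _).trans (hM s right_mem_uIcc)
  set B : ℝ := ‖(1 : R)‖ * Real.exp (K * |s - s₀|) with hB
  have hPB : ∀ t ∈ uIcc s₀ s, ∀ y ∈ Icc (x - 1) (x + 1), ‖P t y‖ ≤ B := by
    intro t ht y hy
    have h := norm_le_of_hasDerivAt_mul (K := K) (s₀ := s₀) (s := t) (fun t => hP t y)
      (fun r hr => hK1 (r, y) ⟨uIcc_subset_uIcc_left ht hr, hy⟩)
    rw [hP0] at h
    refine h.trans ?_
    rw [hB]
    have := abs_sub_left_of_mem_uIcc ht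
    gcongr
  have hAL : ∀ t ∈ uIcc s₀ s, ∀ y ∈ Icc (x - 1) (x + 1), ‖A t y - A t x‖ ≤ C * ‖y - x‖ :=
    fun t ht y hy => (convex_Icc (x - 1) (x + 1)).norm_image_sub_le_of_norm_deriv_le
      (fun z _ => (hasDerivAt_snd_of_contDiff hA t z).differentiableAt)
      (fun z hz => hC (t, z) ⟨ht, hz⟩) hxI hy
  have hvar : ∀ t y, P t y - P t x =
      P t x * ∫ r in s₀..t, Ring.inverse (P r x) * (A r y - A r x) * P r y := by
    intro t y
    rw [inverse_mul_sub_inverse_mul_eq_integral (hAc x) (hAc y) (fun t => hP t x)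
      (fun t => hP t y) (fun t => hu t x), hP0, hP0, mul_sub, ← mul_assoc,
      Ring.mul_inverse_cancel _ (hu t x)]
    simp
  have hcont : ∀ t ∈ uIcc s₀ s, Tendsto (P t) (𝓝 x) (𝓝 (P t x)) := by
    intro t ht
    rw [tendsto_iff_norm_sub_tendsto_zero]
    have h0 : Tendsto (fun y => B * ((M * (C * ‖y - x‖) * B) * |t - s₀|)) (𝓝 x) (𝓝 0) := by
      have : Continuous fun y : ℝ => B * ((M * (C * ‖y - x‖) * B) * |t - s₀|) := by fun_prop
      simpa using this.tendsto x
    refine squeeze_zero' (Eventually.of_forall fun _ => norm_nonneg _) ?_ h0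
    filter_upwards [hnhds] with y hy
    rw [hvar]
    refine (norm_mul_le _ _).trans ?_
    gcongr
    · exact hPB t ht x hxI
    · refine intervalIntegral.norm_integral_le_of_norm_le_const fun r hr => ?_
      have hr' := uIcc_subset_uIcc_left ht (uIoc_subset_uIcc hr)
      refine (norm_mul_le _ _).trans ?_
      gcongr
      · refine (norm_mul_le _ _).trans ?_
        gcongr
        · exact hM r hr'
        · exact hAL r hr' y hy
      · exact hPB r hr' y hy
  rw [hasDerivAt_iff_tendsto_slope]
  have hslope : slope (P s) x = fun y =>
      P s x * ∫ t in s₀..s, Ring.inverse (P t x) * slope (A t) x y * P t y := by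
    ext y
    rw [slope_def_module, hvar, ← mul_smul_comm, ← intervalIntegral.integral_smul]
    simp only [slope_def_module, mul_smul_comm, smul_mul_assoc]
  rw [hslope]
  refine Tendsto.const_mul _ ?_
  have hnhds' : ∀ᶠ y in 𝓝[≠] x, y ∈ Icc (x - 1) (x + 1) := mem_nhdsWithin_of_mem_nhds hnhds
  refine intervalIntegral.tendsto_integral_filter_of_dominated_convergence
    (fun _ => M * C * B) ?_ ?_ intervalIntegrable_const ?_
  · refine Eventually.of_forall fun y => Continuous.aestronglyMeasurable ?_
    simp only [slope_def_module]
    exact (hic.mul (((hAc y).sub (hAc x)).const_smul _)).mul (hPc y)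
  · filter_upwards [hnhds', self_mem_nhdsWithin] with y hy hyx
    refine Eventually.of_forall fun t ht => ?_
    have ht' := uIoc_subset_uIcc ht
    refine (norm_mul_le _ _).trans ?_
    gcongr
    · refine (norm_mul_le _ _).trans ?_
      gcongr
      · exact hM t ht'
      · have hpos : 0 < ‖y - x‖ := norm_pos_iff.2 (sub_ne_zero.2 hyx)
        rw [slope_def_module, norm_smul, norm_inv, inv_mul_le_iff₀ hpos, mul_comm]
        exact hAL t ht' y hy
    · exact hPB t ht' y hy
  · refine Eventually.of_forall fun t ht => ?_
    have hs := hasDerivAt_iff_tendsto_slope.1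
      (hasDerivAt_snd_of_contDiff hA t x).differentiableAt.hasDerivAt
    exact (tendsto_const_nhds.mul hs).mul
      ((hcont t (uIoc_subset_uIcc ht)).mono_left nhdsWithin_le_nhds)

end LinearODE

/-- `T⁻¹ (∂_τ P) P⁻¹ T = ∫_{σ₀}^{σ} T⁻¹(σ',τ) (∂_τ A₁)(σ',τ) T(σ',τ) dσ'`. -/
theorem wilson_param_deriv_integral
    (n : ℕ) (hn : 1 ≤ n)
    (A₀ A₁ : ℝ → ℝ → Matrix (Fin n) (Fin n) ℂ)
    (hA₀ : ContDiff ℝ 1 fun p : ℝ × ℝ => A₀ p.1 p.2)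
    (hA₁ : ContDiff ℝ 1 fun p : ℝ × ℝ => A₁ p.1 p.2)
    (σ₀ τ₀ : ℝ)
    (P Q : ℝ → ℝ → Matrix (Fin n) (Fin n) ℂ)
    (hP : ∀ (σ τ : ℝ), HasDerivAt (fun σ' : ℝ => P σ' τ) (A₁ σ τ * P σ τ) σ)
    (hP0 : ∀ τ : ℝ, P σ₀ τ = 1)
    (hPinv : ∀ (σ τ : ℝ), IsUnit (P σ τ))
    (hQ : ∀ (σ τ : ℝ), HasDerivAt (fun τ' : ℝ => Q σ τ') (A₀ σ τ * Q σ τ) τ)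
    (hQ0 : ∀ σ : ℝ, Q σ τ₀ = 1)
    (hQinv : ∀ (σ τ : ℝ), IsUnit (Q σ τ))
    (T : ℝ → ℝ → Matrix (Fin n) (Fin n) ℂ)
    (hT : ∀ (σ τ : ℝ), T σ τ = P σ τ * Q σ₀ τ) :
    ∀ (σ τ : ℝ),
      (T σ τ)⁻¹ * deriv (fun τ' : ℝ => P σ τ') τ * (P σ τ)⁻¹ * T σ τ =
        ∫ σ' in σ₀..σ,
          (T σ' τ)⁻¹ * deriv (fun τ' : ℝ => A₁ σ' τ') τ * T σ' τ := by
  intro σ τ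
  have hd := hasDerivAt_param_of_linear_ode hA₁ hP hP0 hPinv σ τ
  have hPc : Continuous fun t => P t τ :=
    continuous_iff_continuousAt.2 fun t => (hP t τ).continuousAt
  have hic : Continuous fun t => Ring.inverse (P t τ) :=
    continuous_iff_continuousAt.2 fun t =>
      ((hP t τ).ringInverse_of_isUnit (hPinv t τ)).continuousAt
  have hAd : Continuous fun t => deriv (A₁ t) τ :=
    (continuous_deriv_snd_of_contDiff hA₁).comp (continuous_id.prodMk continuous_const)
  have hint := ((hic.mul hAd).mul hPc).intervalIntegrable (μ := volume) σ₀ σ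
  have hc : ∀ X : Matrix (Fin n) (Fin n) ℂ,
      (P σ τ)⁻¹ * (P σ τ * X) = X := fun X =>
    Matrix.nonsing_inv_mul_cancel_left _ _ ((Matrix.isUnit_iff_isUnit_det _).1 (hPinv σ τ))
  have hd' : deriv (fun τ' : ℝ => P σ τ') τ = _ := hd.deriv
  have hL : (T σ τ)⁻¹ * deriv (fun τ' : ℝ => P σ τ') τ * (P σ τ)⁻¹ * T σ τ =
      (Q σ₀ τ)⁻¹ * (∫ t in σ₀..σ, Ring.inverse (P t τ) * deriv (A₁ t) τ * P t τ) * Q σ₀ τ := by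
    rw [hd', hT, Matrix.mul_inv_rev]
    simp only [mul_assoc, hc]
    rfl
  let L : Matrix (Fin n) (Fin n) ℂ →L[ℝ] Matrix (Fin n) (Fin n) ℂ :=
    ContinuousLinearMap.mulLeftRight ℝ _ (Q σ₀ τ)⁻¹ (Q σ₀ τ)
  rw [hL]
  refine (L.intervalIntegral_comp_comm hint).symm.trans
    (intervalIntegral.integral_congr fun t _ => ?_)
  simp only [L, ContinuousLinearMap.mulLeftRight_apply, hT, Matrix.mul_inv_rev, Pi.mul_apply]
  simp only [Matrix.nonsing_inv_eq_ringInverse, mul_assoc]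
end

section
/- Let A : ℝ → Matrix (Fin n) (Fin n) ℂ be continuous, let g : ℝ → Matrix (Fin n) (Fin n) ℂ be continuously differentiable with g(x) invertible for all x, and define the gauge-transformed function Aᵍ(x) = g(x) * A(x) * g(x)⁻¹ − g(x) * (d/dx)(g⁻¹)(x). Fix a ∈ ℝ and let F be the unique solution of F'(x) = A(x) * F(x) with F(a) = 1. Then x ↦ g(x) * F(x) * g(a)⁻¹ is the unique solution Y of Y'(x) = Aᵍ(x) * Y(x) with Y(a) = 1; that is, the path-ordered exponential transforms as ∏_a^x e^{Aᵍ(s)ds} = g(x) · ∏_a^x e^{A(s)ds} · g(a)⁻¹. -/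
attribute [local instance] Matrix.linftyOpNormedAddCommGroup Matrix.linftyOpNormedRing
  Matrix.linftyOpNormedSpace Matrix.linftyOpNormedAlgebra

/-- Solutions of the linear equation `y' = B y` with continuous `B` in a normed algebra are
determined by their value at one point. -/
theorem eq_of_hasDerivAt_mul_of_continuous {R : Type*} [NormedRing R] [NormedAlgebra ℝ R]
    {B y z : ℝ → R} (hB : Continuous B) (hy : ∀ x, HasDerivAt y (B x * y x) x)
    (hz : ∀ x, HasDerivAt z (B x * z x) x) {a : ℝ} (ha : y a = z a) : y = z := by
  funext x
  obtain ⟨K, hK⟩ := (isCompact_Icc (a := min a x - 1) (b := max a x + 1)).exists_bound_of_continuousOn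
    hB.continuousOn
  have ha_mem : a ∈ Set.Ioo (min a x - 1) (max a x + 1) :=
    ⟨by linarith [min_le_left a x], by linarith [le_max_left a x]⟩
  have hx_mem : x ∈ Set.Ioo (min a x - 1) (max a x + 1) :=
    ⟨by linarith [min_le_right a x], by linarith [le_max_right a x]⟩
  refine ODE_solution_unique_of_mem_Ioo (v := fun t w => B t * w) (s := fun _ => Set.univ)
    (K := K.toNNReal) (fun t ht => ?_) ha_mem (fun t _ => ⟨hy t, Set.mem_univ _⟩)
    (fun t _ => ⟨hz t, Set.mem_univ _⟩) ha hx_mem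
  refine (LipschitzWith.of_dist_le_mul fun u v => ?_).lipschitzOnWith
  rw [dist_eq_norm, dist_eq_norm, ← mul_sub]
  refine (norm_mul_le _ _).trans ?_
  gcongr
  exact (hK t (Set.Ioo_subset_Icc_self ht)).trans (Real.le_coe_toNNReal K)

/-- The derivative of the pointwise inverse of a curve of units in a complete normed algebra. -/
theorem HasDerivAt.ringInverse_of_isUnit_s17 {R : Type*} [NormedRing R] [NormedAlgebra ℝ R]
    [HasSummableGeomSeries R] {g : ℝ → R} {g' : R} {x : ℝ} (hg : HasDerivAt g g' x)
    (hx : IsUnit (g x)) :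
    HasDerivAt (fun y => Ring.inverse (g y))
      (-(Ring.inverse (g x) * g' * Ring.inverse (g x))) x := by
  obtain ⟨u, hu⟩ := hx
  have h := hasFDerivAt_ringInverse (𝕜 := ℝ) u
  rw [hu] at h
  simpa [← hu, Function.comp_def] using h.comp_hasDerivAt x hg

/-- Gauge transformation of the path-ordered exponential:
`∏_a^x e^{Aᵍ(s)ds} = g x · ∏_a^x e^{A(s)ds} · (g a)⁻¹`, where
`Aᵍ = g A g⁻¹ − g (g⁻¹)'`; i.e. `x ↦ g x * F x * (g a)⁻¹` is the unique solution of
`Y' = Aᵍ·Y`, `Y a = 1`. -/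
theorem path_ordered_exponential_gauge_transform (n : ℕ)
    (A : ℝ → Matrix (Fin n) (Fin n) ℂ) (hA : Continuous A)
    (g : ℝ → Matrix (Fin n) (Fin n) ℂ) (hg : ContDiff ℝ 1 g)
    (hginv : ∀ x : ℝ, IsUnit (g x))
    (Ag : ℝ → Matrix (Fin n) (Fin n) ℂ)
    (hAg : ∀ x : ℝ, Ag x =
      g x * A x * (g x)⁻¹ - g x * deriv (fun y : ℝ => (g y)⁻¹) x)
    (a : ℝ) (F : ℝ → Matrix (Fin n) (Fin n) ℂ)
    (hF : ∀ x : ℝ, HasDerivAt F (A x * F x) x) (hFa : F a = 1) :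
    ((∀ x : ℝ, HasDerivAt (fun y : ℝ => g y * F y * (g a)⁻¹)
        (Ag x * (g x * F x * (g a)⁻¹)) x) ∧
      g a * F a * (g a)⁻¹ = 1) ∧
    ∀ Y : ℝ → Matrix (Fin n) (Fin n) ℂ,
      (∀ x : ℝ, HasDerivAt Y (Ag x * Y x) x) → Y a = 1 →
        Y = fun x : ℝ => g x * F x * (g a)⁻¹ := by
  have hdet (x : ℝ) : IsUnit (g x).det := (Matrix.isUnit_iff_isUnit_det _).1 (hginv x)
  have hg' (x : ℝ) : HasDerivAt g (deriv g x) x :=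
    (hg.differentiable one_ne_zero x).hasDerivAt
  have hi (x : ℝ) : HasDerivAt (fun y => (g y)⁻¹) (-((g x)⁻¹ * deriv g x * (g x)⁻¹)) x := by
    simp only [Matrix.nonsing_inv_eq_ringInverse]
    exact HasDerivAt.ringInverse_of_isUnit_s17 (hg' x) (hginv x)
  have hAg' (x : ℝ) : Ag x = g x * A x * (g x)⁻¹ + deriv g x * (g x)⁻¹ := by
    have hd : deriv (fun y => (g y)⁻¹) x = -((g x)⁻¹ * deriv g x * (g x)⁻¹) := (hi x).deriv
    rw [hAg, hd, mul_neg, sub_neg_eq_add, mul_assoc (g x)⁻¹,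
      Matrix.mul_nonsing_inv_cancel_left _ _ (hdet x)]
  have hAg_cont : Continuous Ag := by
    rw [funext hAg']
    have hic : Continuous fun y => (g y)⁻¹ :=
      continuous_iff_continuousAt.2 fun x => (hi x).continuousAt
    exact ((hg.continuous.mul hA).mul hic).add ((hg.continuous_deriv le_rfl).mul hic)
  have hsol (x : ℝ) : HasDerivAt (fun y : ℝ => g y * F y * (g a)⁻¹)
      (Ag x * (g x * F x * (g a)⁻¹)) x := by
    have hval : Ag x * (g x * F x * (g a)⁻¹) =
        (deriv g x * F x + g x * (A x * F x)) * (g a)⁻¹ := by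
      rw [hAg']
      simp only [add_mul, mul_assoc, Matrix.nonsing_inv_mul_cancel_left _ _ (hdet x)]
      exact add_comm _ _
    rw [hval]
    exact HasDerivAt.mul_const (HasDerivAt.mul (hg' x) (hF x)) (g a)⁻¹
  have hinit : g a * F a * (g a)⁻¹ = 1 := by
    rw [hFa, mul_one, Matrix.mul_nonsing_inv _ (hdet a)]
  exact ⟨⟨hsol, hinit⟩, fun Y hY hYa =>
    eq_of_hasDerivAt_mul_of_continuous hAg_cont hY hsol (hYa.trans hinit.symm)⟩
end

section
/- With the Wilson-loop setup below and a gauge transformation g : ℝ × ℝ → Matrix (Fin n) (Fin n) ℂ (continuously differentiable with invertible values), let A₀ᵍ = g * A₀ * g⁻¹ − g * ∂_τ(g⁻¹), A₁ᵍ = g * A₁ * g⁻¹ − g * ∂_σ(g⁻¹), and let Pᵍ, Qᵍ, Tᵍ be constructed from A₀ᵍ, A₁ᵍ exactly as P, Q, T are constructed from A₀, A₁. Then for all (σ, τ): Tᵍ(σ, τ) = g(σ, τ) * T(σ, τ) * g(σ₀, τ₀)⁻¹. -/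
attribute [local instance] Matrix.linftyOpNormedAddCommGroup Matrix.linftyOpNormedRing
  Matrix.linftyOpNormedSpace Matrix.linftyOpNormedAlgebra

/-- The derivative of the pointwise inverse of a matrix-valued curve. -/
theorem HasDerivAt.matrix_nonsing_inv {n : ℕ} {u : ℝ → Matrix (Fin n) (Fin n) ℂ}
    {u' : Matrix (Fin n) (Fin n) ℂ} {t : ℝ} (hu : HasDerivAt u u' t) (hunit : IsUnit (u t)) :
    HasDerivAt (fun s => (u s)⁻¹) (-((u t)⁻¹ * u' * (u t)⁻¹)) t := by
  obtain ⟨x, hx⟩ := hunit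
  have h := hasFDerivAt_ringInverse (𝕜 := ℝ) x
  rw [hx] at h
  have h2 := h.comp_hasDerivAt t hu
  simp only [Function.comp_def, ← Matrix.nonsing_inv_eq_ringInverse] at h2
  rw [← hx, ← Matrix.coe_units_inv]
  simp only [neg_apply, ContinuousLinearMap.mulLeftRight_apply] at h2
  exact h2

/-- Gauge covariance of parallel transport along a curve: if `U` and `V` are the parallel
transports of `a` and of its gauge transform by `g`, based at `t₀`, then
`V t = g t * U t * (g t₀)⁻¹`. -/
theorem parallel_transport_gauge_transform {n : ℕ}
    {a g U V : ℝ → Matrix (Fin n) (Fin n) ℂ} {t₀ : ℝ}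
    (hg : Differentiable ℝ g) (hginv : ∀ t, IsUnit (g t))
    (hU : ∀ t, HasDerivAt U (a t * U t) t) (hU0 : U t₀ = 1)
    (hV : ∀ t, HasDerivAt V
      ((g t * a t * (g t)⁻¹ - g t * deriv (fun s => (g s)⁻¹) t) * V t) t)
    (hV0 : V t₀ = 1) (hVinv : ∀ t, IsUnit (V t)) (t : ℝ) :
    V t = g t * U t * (g t₀)⁻¹ := by
  have hgl : ∀ s, (g s)⁻¹ * g s = 1 := fun s =>
    Matrix.nonsing_inv_mul _ ((Matrix.isUnit_iff_isUnit_det _).1 (hginv s))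
  have hgr : ∀ s, g s * (g s)⁻¹ = 1 := fun s =>
    Matrix.mul_nonsing_inv _ ((Matrix.isUnit_iff_isUnit_det _).1 (hginv s))
  have hVr : ∀ s, V s * (V s)⁻¹ = 1 := fun s =>
    Matrix.mul_nonsing_inv _ ((Matrix.isUnit_iff_isUnit_det _).1 (hVinv s))
  have hconst : ∀ s, HasDerivAt (fun r => (V r)⁻¹ * (g r * U r)) 0 s := by
    intro s
    have hgs := (hg s).hasDerivAt
    have h := ((hV s).matrix_nonsing_inv (hVinv s)).mul (hgs.mul (hU s))
    have hinv : deriv (fun r => (g r)⁻¹) s = -((g s)⁻¹ * deriv g s * (g s)⁻¹) :=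
      (hgs.matrix_nonsing_inv (hginv s)).deriv
    rw [hinv] at h
    set g' := deriv g s
    have hform : (g s * a s * (g s)⁻¹ - g s * -((g s)⁻¹ * g' * (g s)⁻¹)) * g s
        = g s * a s + g' := by
      calc _ = g s * a s * ((g s)⁻¹ * g s) + (g s * (g s)⁻¹) * g' * ((g s)⁻¹ * g s) := by
            noncomm_ring
        _ = _ := by simp [hgl, hgr]
    generalize g s * a s * (g s)⁻¹ - g s * -((g s)⁻¹ * g' * (g s)⁻¹) = b at h hform
    have hzero : -((V s)⁻¹ * (b * V s) * (V s)⁻¹) * (g s * U s)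
        + (V s)⁻¹ * (g' * U s + g s * (a s * U s)) = 0 := by
      calc _ = -((V s)⁻¹ * b * (V s * (V s)⁻¹) * (g s * U s))
              + (V s)⁻¹ * (g' * U s + g s * (a s * U s)) := by noncomm_ring
        _ = -((V s)⁻¹ * (b * g s) * U s) + (V s)⁻¹ * (g' * U s + g s * (a s * U s)) := by
              rw [hVr]; noncomm_ring
        _ = 0 := by rw [hform]; noncomm_ring
    rw [← hzero]
    exact h
  have h := is_const_of_deriv_eq_zero (fun s => (hconst s).differentiableAt)
    (fun s => (hconst s).deriv) t t₀
  simp only [hV0, hU0, inv_one, one_mul, mul_one] at h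
  calc V t = V t * (g t₀ * (g t₀)⁻¹) := by rw [hgr, mul_one]
    _ = (V t * (V t)⁻¹) * (g t * U t) * (g t₀)⁻¹ := by rw [← h]; noncomm_ring
    _ = _ := by rw [hVr, one_mul]

/-- Gauge transformation of the composite Wilson line:
`Tᵍ(σ,τ) = g(σ,τ) T(σ,τ) g(σ₀,τ₀)⁻¹`. -/
theorem wilson_line_gauge_transform
    (n : ℕ) (hn : 1 ≤ n)
    (A₀ A₁ : ℝ → ℝ → Matrix (Fin n) (Fin n) ℂ)
    (hA₀ : ContDiff ℝ 1 fun p : ℝ × ℝ => A₀ p.1 p.2)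
    (hA₁ : ContDiff ℝ 1 fun p : ℝ × ℝ => A₁ p.1 p.2)
    (σ₀ τ₀ : ℝ)
    (P Q : ℝ → ℝ → Matrix (Fin n) (Fin n) ℂ)
    (hP : ∀ (σ τ : ℝ), HasDerivAt (fun σ' : ℝ => P σ' τ) (A₁ σ τ * P σ τ) σ)
    (hP0 : ∀ τ : ℝ, P σ₀ τ = 1)
    (hPinv : ∀ (σ τ : ℝ), IsUnit (P σ τ))
    (hQ : ∀ (σ τ : ℝ), HasDerivAt (fun τ' : ℝ => Q σ τ') (A₀ σ τ * Q σ τ) τ)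
    (hQ0 : ∀ σ : ℝ, Q σ τ₀ = 1)
    (hQinv : ∀ (σ τ : ℝ), IsUnit (Q σ τ))
    (T : ℝ → ℝ → Matrix (Fin n) (Fin n) ℂ)
    (hT : ∀ (σ τ : ℝ), T σ τ = P σ τ * Q σ₀ τ)
    (g : ℝ → ℝ → Matrix (Fin n) (Fin n) ℂ)
    (hg : ContDiff ℝ 1 fun p : ℝ × ℝ => g p.1 p.2)
    (hginv : ∀ (σ τ : ℝ), IsUnit (g σ τ))
    (A₀g A₁g : ℝ → ℝ → Matrix (Fin n) (Fin n) ℂ)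
    (hA₀g : ∀ (σ τ : ℝ), A₀g σ τ =
      g σ τ * A₀ σ τ * (g σ τ)⁻¹ - g σ τ * deriv (fun τ' : ℝ => (g σ τ')⁻¹) τ)
    (hA₁g : ∀ (σ τ : ℝ), A₁g σ τ =
      g σ τ * A₁ σ τ * (g σ τ)⁻¹ - g σ τ * deriv (fun σ' : ℝ => (g σ' τ)⁻¹) σ)
    (Pg Qg : ℝ → ℝ → Matrix (Fin n) (Fin n) ℂ)
    (hPg : ∀ (σ τ : ℝ), HasDerivAt (fun σ' : ℝ => Pg σ' τ) (A₁g σ τ * Pg σ τ) σ)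
    (hPg0 : ∀ τ : ℝ, Pg σ₀ τ = 1)
    (hPginv : ∀ (σ τ : ℝ), IsUnit (Pg σ τ))
    (hQg : ∀ (σ τ : ℝ), HasDerivAt (fun τ' : ℝ => Qg σ τ') (A₀g σ τ * Qg σ τ) τ)
    (hQg0 : ∀ σ : ℝ, Qg σ τ₀ = 1)
    (hQginv : ∀ (σ τ : ℝ), IsUnit (Qg σ τ))
    (Tg : ℝ → ℝ → Matrix (Fin n) (Fin n) ℂ)
    (hTg : ∀ (σ τ : ℝ), Tg σ τ = Pg σ τ * Qg σ₀ τ) :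
    ∀ (σ τ : ℝ), Tg σ τ = g σ τ * T σ τ * (g σ₀ τ₀)⁻¹ := by
  intro σ τ
  have hgd := hg.differentiable one_ne_zero
  have hP' : Pg σ τ = g σ τ * P σ τ * (g σ₀ τ)⁻¹ := by
    refine parallel_transport_gauge_transform (a := fun s => A₁ s τ) (g := fun s => g s τ)
      (U := fun s => P s τ) (V := fun s => Pg s τ)
      (hgd.comp (differentiable_id.prodMk (differentiable_const τ))) (fun s => hginv s τ)
      (fun s => hP s τ) (hP0 τ) (fun s => ?_) (hPg0 τ) (fun s => hPginv s τ) σ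
    simpa only [hA₁g] using hPg s τ
  have hQ' : Qg σ₀ τ = g σ₀ τ * Q σ₀ τ * (g σ₀ τ₀)⁻¹ := by
    refine parallel_transport_gauge_transform (a := A₀ σ₀) (g := g σ₀) (U := Q σ₀) (V := Qg σ₀)
      (hgd.comp ((differentiable_const σ₀).prodMk differentiable_id)) (hginv σ₀)
      (hQ σ₀) (hQ0 σ₀) (fun s => ?_) (hQg0 σ₀) (hQginv σ₀) τ
    simpa only [hA₀g] using hQg σ₀ s
  have hgl : (g σ₀ τ)⁻¹ * g σ₀ τ = 1 :=
    Matrix.nonsing_inv_mul _ ((Matrix.isUnit_iff_isUnit_det _).1 (hginv σ₀ τ))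
  calc Tg σ τ = g σ τ * P σ τ * ((g σ₀ τ)⁻¹ * g σ₀ τ) * Q σ₀ τ * (g σ₀ τ₀)⁻¹ := by
        rw [hTg, hP', hQ']; noncomm_ring
    _ = _ := by rw [hgl, hT, mul_one, mul_assoc (g σ τ)]
end
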